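/- Fix δ ∈ (0,1/2). Let k ≥ 1, let A_1, …, A_k be pairwise disjoint bounded rectangles in [0,1]^d, and let R_1, …, R_k ⊆ (−∞,+∞] each be a finite union of disjoint intervals of the form (x,y] with −∞ < x < y ≤ +∞. Then P( for every j ∈ {1,…,k} and every α ∈ V_N^δ with α/n ∈ A_j one has (ψ_α − b_N)/a_N ∉ R_j ) converges, as n → ∞, to exp(−Σ_{j=1}^k |A_j ∩ [δ,1−δ]^d|·ω(R_j)). (This is the avoidance-probability formulation of the convergence of the bulk extremal process Σ_{α∈V_N^δ} ε_{(α/n, (ψ_α−b_N)/a_N)} to a Poisson point process with intensity dt restricted to [δ,1−δ]^d tensor e^{−z}dz.) -/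

import Mathlib

open MeasureTheory ProbabilityTheory Real Filter Set

/-- `ℤ^d` as functions `Fin d → ℤ`. -/
abbrev Zd (d : ℕ) := Fin d → ℤ

/-- One step of the simple random walk: move from `a` by `±1` in coordinate `i`. -/
def rwStep (d : ℕ) (i : Fin d) (s : Bool) (a : Zd d) : Zd d :=
  Function.update a i (a i + if s then 1 else -1)

/-- `m`-step transition probability of the simple random walk on `ℤ^d`. -/
noncomputable def rwP (d : ℕ) : ℕ → Zd d → Zd d → ℝ
  | 0, a, b => if a = b then 1 else 0
  | (m+1), a, b => (1 / (2 * d)) * ∑ i : Fin d, ∑ s : Bool, rwP d m (rwStep d i s a) b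

/-- The Green's function `g(a,b)` of the simple random walk on `ℤ^d`. -/
noncomputable def green (d : ℕ) (a b : Zd d) : ℝ := ∑' m, rwP d m a b

open Classical in
/-- Probability that the walk started at `a` is at `b` at time `m`, having stayed in `Λ`
at all times `0,…,m`. -/
noncomputable def rwPIn (d : ℕ) (Λ : Set (Zd d)) : ℕ → Zd d → Zd d → ℝ
  | 0, a, b => if a = b ∧ a ∈ Λ then 1 else 0
  | (m+1), a, b =>
      if a ∈ Λ then (1 / (2 * d)) * ∑ i : Fin d, ∑ s : Bool, rwPIn d Λ m (rwStep d i s a) b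
      else 0

/-- Dirichlet Green's function `g_Λ(a,b)` (killed upon exiting `Λ`). -/
noncomputable def greenIn (d : ℕ) (Λ : Set (Zd d)) (a b : Zd d) : ℝ := ∑' m, rwPIn d Λ m a b

open Classical in
/-- Probability that the walk started at `a` first hits `F` at time `m`, at the point `b`. -/
noncomputable def hitP (d : ℕ) (F : Set (Zd d)) : ℕ → Zd d → Zd d → ℝ
  | 0, a, b => if a = b ∧ b ∈ F then 1 else 0
  | (m+1), a, b =>
      if a ∈ F then 0
      else (1 / (2 * d)) * ∑ i : Fin d, ∑ s : Bool, hitP d F m (rwStep d i s a) b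

open Classical in
/-- Probability that the walk started at `a` first hits `F` at time `m`, at the point `b`,
before exiting `Λ`. -/
noncomputable def hitPIn (d : ℕ) (Λ F : Set (Zd d)) : ℕ → Zd d → Zd d → ℝ
  | 0, a, b => if a = b ∧ b ∈ F ∧ b ∈ Λ then 1 else 0
  | (m+1), a, b =>
      if a ∈ Λ ∧ a ∉ F then
        (1 / (2 * d)) * ∑ i : Fin d, ∑ s : Bool, hitPIn d Λ F m (rwStep d i s a) b
      else 0

/-- `ℙ_a(H_F < ∞, S_{H_F} = b)`, the harmonic measure of `F` seen from `a`. -/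
noncomputable def hitMeas (d : ℕ) (F : Set (Zd d)) (a b : Zd d) : ℝ := ∑' m, hitP d F m a b

/-- `ℙ_a(H_F < H_{ℤ^d∖Λ}, S_{H_F} = b)`. -/
noncomputable def hitMeasIn (d : ℕ) (Λ F : Set (Zd d)) (a b : Zd d) : ℝ :=
  ∑' m, hitPIn d Λ F m a b

/-- `(φ_a)_{a∈ℤ^d}` is a centered Gaussian field with covariance `G`: every finite linear
combination is a centered Gaussian with the prescribed variance. -/
def IsGaussianField {Ω : Type*} [MeasurableSpace Ω] (P : Measure Ω) (d : ℕ)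
    (G : Zd d → Zd d → ℝ) (φ : Zd d → Ω → ℝ) : Prop :=
  (∀ a, Measurable (φ a)) ∧
    ∀ c : Zd d →₀ ℝ,
      Measure.map (fun ω => ∑ a ∈ c.support, c a * φ a ω) P =
        gaussianReal 0
          (Real.toNNReal (∑ a ∈ c.support, ∑ b ∈ c.support, c a * c b * G a b))

/-- The centering sequence `b_N` (here `g0 = g(0)` is the variance of the field). -/
noncomputable def bN (g0 : ℝ) (N : ℕ) : ℝ :=
  Real.sqrt g0 * (Real.sqrt (2 * Real.log N) -
    (Real.log (Real.log N) + Real.log (4 * π)) / (2 * Real.sqrt (2 * Real.log N)))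

/-- The scaling sequence `a_N = g(0)/b_N`. -/
noncomputable def aN (g0 : ℝ) (N : ℕ) : ℝ := g0 / bN g0 N

/-- `u_N(z) = a_N z + b_N`. -/
noncomputable def uN (g0 : ℝ) (N : ℕ) (z : ℝ) : ℝ := aN g0 N * z + bN g0 N

/-- The box `V_N = ([0,n-1]^d) ∩ ℤ^d`, `N = n^d`. -/
noncomputable def VN (d n : ℕ) : Finset (Zd d) :=
  Fintype.piFinset fun _ => Finset.Icc (0 : ℤ) ((n : ℤ) - 1)

/-- The `ℓ∞` distance between two points of `ℤ^d`, as a real number. -/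
noncomputable def distInf (d : ℕ) (a b : Zd d) : ℝ :=
  ((Finset.univ.sup fun i => (a i - b i).natAbs : ℕ) : ℝ)

open Classical in
/-- The bulk `V_N^δ` of the box `V_N`. -/
noncomputable def bulk (d n : ℕ) (δ : ℝ) : Finset (Zd d) :=
  (VN d n).filter fun a => ∀ b : Zd d, b ∉ VN d n → δ * n < distInf d a b

/-- The rectangle `∏_i ([0,1] ∩ (lo i, hi i])` in `[0,1]^d`. -/
def rect (d : ℕ) (lo hi : Fin d → ℝ) : Set (Fin d → ℝ) :=
  {t | ∀ i, t i ∈ Set.Icc (0 : ℝ) 1 ∩ Set.Ioc (lo i) (hi i)}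

open Classical in
/-- `nA ∩ V_N = {α ∈ V_N : α/n ∈ A}` for the rectangle `A = rect d lo hi`. -/
noncomputable def rectIdx (d n : ℕ) (lo hi : Fin d → ℝ) : Finset (Zd d) :=
  (VN d n).filter fun a => (fun i => (a i : ℝ) / n) ∈ rect d lo hi

/-- `e^{-y}` for `y ∈ (-∞,+∞]`, with the convention `e^{-∞} = 0`. -/
noncomputable def expE (y : EReal) : ℝ := if y = ⊤ then 0 else Real.exp (-y.toReal)

/-- `u_N` extended to `(-∞,+∞]` by `u_N(+∞) = +∞`. -/
noncomputable def uNE (g0 : ℝ) (N : ℕ) (y : EReal) : EReal :=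
  if y = ⊤ then ⊤ else ((uN g0 N y.toReal : ℝ) : EReal)

/-- `ω(R) = ∫_R e^{-z} dz` for `R ⊆ (-∞,+∞]`. -/
noncomputable def omegaMeas (R : Set EReal) : ℝ :=
  ∫ t in {t : ℝ | (t : EReal) ∈ R}, Real.exp (-t)

/-- `R ⊆ (-∞,+∞]` is a finite union of disjoint intervals `(x,y]` with
`-∞ < x < y ≤ +∞`. -/
def IsFiniteUnionIoc (R : Set EReal) : Prop :=
  ∃ (m : ℕ) (w : Fin m → ℝ) (r : Fin m → EReal),
    (∀ l, (w l : EReal) < r l) ∧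
    (Pairwise fun l l' =>
      Disjoint (Set.Ioc (w l : EReal) (r l)) (Set.Ioc (w l' : EReal) (r l'))) ∧
    R = ⋃ l, Set.Ioc ((w l : ℝ) : EReal) (r l)


/-- The box `[δ, 1-δ]^d`. -/
def deltaBox (d : ℕ) (δ : ℝ) : Set (Fin d → ℝ) := {t | ∀ i, t i ∈ Set.Icc δ (1 - δ)}

open Classical in
/-- `{α ∈ V_N^δ : α/n ∈ A}` for the rectangle `A = rect d lo hi`. -/
noncomputable def rectIdxBulk (d n : ℕ) (δ : ℝ) (lo hi : Fin d → ℝ) : Finset (Zd d) :=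
  (bulk d n δ).filter fun a => (fun i => (a i : ℝ) / n) ∈ rect d lo hi

/-! ### Fourier representation of the simple random walk -/

/-- Lebesgue measure on the frequency cube `(-π, π]^d`. -/
noncomputable abbrev fourierCube (d : ℕ) : Measure (Fin d → ℝ) :=
  Measure.pi fun _ => volume.restrict (Ioc (-π) π)

/-- The characteristic function `(1/d) ∑ cos θ_i` of one step of the walk. -/
noncomputable def stepChar (d : ℕ) (θ : Fin d → ℝ) : ℝ := (1 / d) * ∑ i, cos (θ i)

lemma continuous_stepChar (d : ℕ) : Continuous (stepChar d) := by
  unfold stepChar; fun_prop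

lemma abs_stepChar_le_avg (d : ℕ) (θ : Fin d → ℝ) :
    |stepChar d θ| ≤ (1 / d) * ∑ i, |cos (θ i)| := by
  rw [stepChar, abs_mul, abs_of_nonneg (by positivity : (0 : ℝ) ≤ 1 / d)]
  gcongr
  exact Finset.abs_sum_le_sum_abs _ _

lemma abs_stepChar_le_one (d : ℕ) (θ : Fin d → ℝ) : |stepChar d θ| ≤ 1 := by
  refine (abs_stepChar_le_avg d θ).trans ?_
  have h : ∑ i, |cos (θ i)| ≤ d := by
    simpa using Finset.sum_le_sum fun i (_ : i ∈ Finset.univ) => abs_cos_le_one (θ i)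
  rcases Nat.eq_zero_or_pos d with rfl | hd
  · simp
  · have : (0 : ℝ) < d := by exact_mod_cast hd
    rw [one_div, inv_mul_le_iff₀ this]; linarith

lemma integrable_fourierCube_of_bound {d : ℕ} {f : (Fin d → ℝ) → ℝ} (hf : Continuous f) (C : ℝ)
    (h : ∀ θ, |f θ| ≤ C) : Integrable f (fourierCube d) :=
  Integrable.of_bound hf.aestronglyMeasurable C (ae_of_all _ h)

lemma integral_Ioc_exp_int (x : ℤ) :
    ∫ t in Ioc (-π) π, Complex.exp (Complex.I * x * t) = if x = 0 then (2 * π : ℂ) else 0 := by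
  rw [← intervalIntegral.integral_of_le (by linarith [pi_pos])]
  split_ifs with h
  · simp only [h, Int.cast_zero, mul_zero, zero_mul, Complex.exp_zero,
      intervalIntegral.integral_const]
    push_cast [Complex.real_smul]; ring
  · have hc : Complex.I * (x : ℂ) ≠ 0 := mul_ne_zero Complex.I_ne_zero (by exact_mod_cast h)
    rw [integral_exp_mul_complex hc]
    have : Complex.exp (Complex.I * x * (π : ℝ)) = Complex.exp (Complex.I * x * ((-π : ℝ) : ℂ)) := by
      rw [Complex.exp_eq_exp_iff_exists_int]
      refine ⟨x, ?_⟩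
      push_cast; ring
    rw [this, sub_self, zero_div]

lemma integral_fourierCube_cos (d : ℕ) (x : Zd d) :
    ∫ θ, cos (∑ i, x i * θ i) ∂(fourierCube d) = if x = 0 then (2 * π) ^ d else 0 := by
  have h1 : ∫ θ, Complex.exp (Complex.I * (∑ i, x i * θ i : ℝ)) ∂(fourierCube d)
      = ∏ i, (if x i = 0 then (2 * π : ℂ) else 0) := by
    rw [← Finset.prod_congr rfl fun i _ => integral_Ioc_exp_int (x i),
      ← integral_fintype_prod_eq_prod
        (fun (i : Fin d) (t : ℝ) => Complex.exp (Complex.I * x i * t))]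
    congr 1; ext θ
    rw [← Complex.exp_sum]
    push_cast
    rw [Finset.mul_sum]
    congr 1
    exact Finset.sum_congr rfl fun i _ => by ring
  have h2 : Integrable (fun θ : Fin d → ℝ => Complex.exp (Complex.I * (∑ i, x i * θ i : ℝ)))
      (fourierCube d) := by
    refine Integrable.of_bound (Continuous.aestronglyMeasurable (by fun_prop)) 1
      (ae_of_all _ fun θ => ?_)
    rw [mul_comm, Complex.norm_exp_ofReal_mul_I]
  have h3 := integral_re (𝕜 := ℂ) h2
  rw [h1] at h3
  have h4 : ∀ y : ℝ, RCLike.re (Complex.exp (Complex.I * (y : ℂ))) = cos y := by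
    intro y
    rw [mul_comm]
    exact Complex.exp_ofReal_mul_I_re y
  simp only [h4] at h3
  rw [h3]
  split_ifs with hx
  · simp only [hx, Pi.zero_apply, if_true, Finset.prod_const, Finset.card_univ, Fintype.card_fin]
    have : ((2 : ℂ) * π) ^ d = (((2 * π) ^ d : ℝ) : ℂ) := by push_cast; ring
    rw [this]; exact Complex.ofReal_re _
  · obtain ⟨i, hi⟩ := Function.ne_iff.1 hx
    rw [Finset.prod_eq_zero (Finset.mem_univ i) (if_neg (by simpa using hi))]
    simp

/-- The Fourier integrand of the `m`-step transition probability. -/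
lemma integrable_stepChar_pow_mul_cos (d m : ℕ) (x : Zd d) :
    Integrable (fun θ => stepChar d θ ^ m * cos (∑ i, x i * θ i)) (fourierCube d) := by
  refine integrable_fourierCube_of_bound
    (((continuous_stepChar d).pow m).mul (by fun_prop)) 1 fun θ => ?_
  rw [abs_mul, abs_pow]
  exact mul_le_one₀ (pow_le_one₀ (abs_nonneg _) (abs_stepChar_le_one d θ)) (abs_nonneg _)
    (abs_cos_le_one _)

lemma sum_rwStep_cos (d : ℕ) (a b : Zd d) (θ : Fin d → ℝ) (i : Fin d) :
    ∑ s : Bool, cos (∑ j, ((b - rwStep d i s a) j : ℝ) * θ j)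
      = 2 * cos (∑ j, ((b - a) j : ℝ) * θ j) * cos (θ i) := by
  have key : ∀ s : Bool, ∑ j, ((b - rwStep d i s a) j : ℝ) * θ j
      = ∑ j, ((b - a) j : ℝ) * θ j - (if s then 1 else -1) * θ i := by
    intro s
    rw [eq_sub_iff_add_eq, ← Finset.add_sum_erase _ _ (Finset.mem_univ i),
      ← Finset.add_sum_erase _ (fun j => ((b - a) j : ℝ) * θ j) (Finset.mem_univ i)]
    have : ∑ j ∈ Finset.univ.erase i, ((b - rwStep d i s a) j : ℝ) * θ j
        = ∑ j ∈ Finset.univ.erase i, ((b - a) j : ℝ) * θ j := by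
      refine Finset.sum_congr rfl fun j hj => ?_
      rw [Pi.sub_apply, Pi.sub_apply, rwStep, Function.update_of_ne (Finset.ne_of_mem_erase hj)]
    rw [this, Pi.sub_apply, Pi.sub_apply, rwStep, Function.update_self]
    cases s <;> simp <;> ring
  rw [Fintype.sum_bool, key, key]
  simp only [if_true, Bool.false_eq_true, if_false]
  rw [show ∀ t : ℝ, t - -1 * θ i = t + θ i by intro; ring, one_mul, cos_add, cos_sub]
  ring

lemma rwP_eq_integral {d : ℕ} (hd : 0 < d) (m : ℕ) (a b : Zd d) :
    rwP d m a b = ((2 * π) ^ d)⁻¹ *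
      ∫ θ, stepChar d θ ^ m * cos (∑ i, ((b - a) i : ℝ) * θ i) ∂(fourierCube d) := by
  have hd' : (d : ℝ) ≠ 0 := by positivity
  induction m generalizing a with
  | zero =>
    simp only [rwP, pow_zero, one_mul]
    have := integral_fourierCube_cos d (b - a)
    rw [this]
    by_cases h : a = b
    · subst h
      simp only [sub_self, if_true]
      rw [inv_mul_cancel₀ (by positivity)]
    · rw [if_neg h, if_neg (sub_ne_zero.2 (Ne.symm h)), mul_zero]
  | succ m ih =>
    simp only [rwP]
    have hF := fun (i : Fin d) (s : Bool) => integrable_stepChar_pow_mul_cos d m (b - rwStep d i s a)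
    simp_rw [ih, ← Finset.mul_sum]
    rw [mul_left_comm]
    congr 1
    simp_rw [← integral_finsetSum _ fun s _ => hF _ s]
    rw [← integral_finsetSum _ fun i _ => integrable_finsetSum _ fun s _ => hF i s,
      ← integral_const_mul]
    congr 1; ext θ
    simp_rw [← Finset.mul_sum, sum_rwStep_cos]
    rw [← Finset.mul_sum, pow_succ, stepChar]
    field_simp

/-- `(2π)^{-d} ∫ |φ|^m`, a bound on all `m`-step transition probabilities. -/
noncomputable def heatBound (d m : ℕ) : ℝ :=
  ((2 * π) ^ d)⁻¹ * ∫ θ, |stepChar d θ| ^ m ∂(fourierCube d)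

lemma rwP_le_heatBound {d : ℕ} (hd : 0 < d) (m : ℕ) (a b : Zd d) :
    rwP d m a b ≤ heatBound d m := by
  rw [rwP_eq_integral hd, heatBound]
  gcongr
  · exact integrable_stepChar_pow_mul_cos d m (b - a)
  · exact integrable_fourierCube_of_bound ((continuous_stepChar d).abs.pow m) 1 fun θ => by
      rw [abs_pow, abs_abs]; exact pow_le_one₀ (abs_nonneg _) (abs_stepChar_le_one d θ)
  · intro θ
    refine (le_abs_self _).trans ?_
    rw [abs_mul, abs_pow]
    exact mul_le_of_le_one_right (by positivity) (abs_cos_le_one _)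

lemma rwP_nonneg (d m : ℕ) (a b : Zd d) : 0 ≤ rwP d m a b := by
  induction m generalizing a with
  | zero => simp only [rwP]; split_ifs <;> norm_num
  | succ m ih =>
    simp only [rwP]
    exact mul_nonneg (by positivity) (Finset.sum_nonneg fun i _ => Finset.sum_nonneg fun s _ => ih _)

lemma rwP_even_add_odd_le {d : ℕ} (hd : 0 < d) (m : ℕ) (a b c : Zd d) :
    rwP d (2 * m) a b + rwP d (2 * m + 1) a b ≤ rwP d (2 * m) c c + rwP d (2 * m + 1) c c := by
  simp only [rwP_eq_integral hd, ← mul_add]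
  rw [← integral_add (integrable_stepChar_pow_mul_cos d _ _)
      (integrable_stepChar_pow_mul_cos d _ _),
    ← integral_add (integrable_stepChar_pow_mul_cos d _ _)
      (integrable_stepChar_pow_mul_cos d _ _)]
  refine mul_le_mul_of_nonneg_left (integral_mono
    ((integrable_stepChar_pow_mul_cos d _ _).add (integrable_stepChar_pow_mul_cos d _ _))
    ((integrable_stepChar_pow_mul_cos d _ _).add (integrable_stepChar_pow_mul_cos d _ _))
    fun θ => ?_) (by positivity)
  simp only [sub_self, Pi.zero_apply, Int.cast_zero, zero_mul, Finset.sum_const_zero, cos_zero,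
    mul_one]
  rw [← add_mul]
  refine mul_le_of_le_one_right ?_ (cos_le_one _)
  have h1 := neg_le_of_abs_le (abs_stepChar_le_one d θ)
  rw [pow_succ, pow_mul]
  have : 0 ≤ (stepChar d θ ^ 2) ^ m := by positivity
  nlinarith

lemma rwP_self {d : ℕ} (hd : 0 < d) (m : ℕ) (a : Zd d) : rwP d m a a = rwP d m 0 0 := by
  simp [rwP_eq_integral hd]

/-! ### Heat-kernel and Green's function estimates -/

lemma exp_neg_sin_sq_le {c : ℝ} (hc : 0 ≤ c) {t : ℝ} (ht : t ∈ Ioc (-π) π) :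
    exp (-(c * sin t ^ 2)) ≤ exp (-(c * (4 / π ^ 2)) * t ^ 2)
      + exp (-(c * (4 / π ^ 2)) * (t - π) ^ 2) + exp (-(c * (4 / π ^ 2)) * (t + π) ^ 2) := by
  have key : ∀ x : ℝ, |x| ≤ π / 2 →
      exp (-(c * sin x ^ 2)) ≤ exp (-(c * (4 / π ^ 2)) * x ^ 2) := by
    intro x hx
    have h1 : (2 / π * |x|) ^ 2 ≤ |sin x| ^ 2 :=
      pow_le_pow_left₀ (by positivity) (mul_abs_le_abs_sin hx) 2
    rw [mul_pow, sq_abs, sq_abs, div_pow] at h1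
    rw [exp_le_exp, neg_mul, neg_le_neg_iff, mul_assoc]
    refine mul_le_mul_of_nonneg_left ?_ hc
    norm_num at h1 ⊢
    exact h1
  have e1 := exp_pos (-(c * (4 / π ^ 2)) * t ^ 2)
  have e2 := exp_pos (-(c * (4 / π ^ 2)) * (t - π) ^ 2)
  have e3 := exp_pos (-(c * (4 / π ^ 2)) * (t + π) ^ 2)
  rcases le_or_gt |t| (π / 2) with h | h
  · linarith [key t h]
  rcases lt_abs.1 h with h | h
  · have := key (t - π) (abs_le.2 ⟨by linarith, by linarith [ht.2, pi_pos]⟩)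
    rw [sin_sub_pi, neg_sq] at this
    linarith
  · have := key (t + π) (abs_le.2 ⟨by linarith [ht.1, pi_pos], by linarith⟩)
    rw [sin_add_pi, neg_sq] at this
    linarith

lemma integral_exp_neg_sin_sq_le {c : ℝ} (hc : 0 < c) :
    ∫ t in Ioc (-π) π, exp (-(c * sin t ^ 2)) ≤ 3 * √(π / (c * (4 / π ^ 2))) := by
  have hb : 0 < c * (4 / π ^ 2) := by positivity
  have i1 := integrable_exp_neg_mul_sq hb
  have i2 := i1.comp_sub_right π
  have i3 := i1.comp_add_right π
  calc _ ≤ ∫ t in Ioc (-π) π, (exp (-(c * (4 / π ^ 2)) * t ^ 2)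
      + exp (-(c * (4 / π ^ 2)) * (t - π) ^ 2) + exp (-(c * (4 / π ^ 2)) * (t + π) ^ 2)) := by
        refine setIntegral_mono_on ?_ ((i1.add i2).add i3).integrableOn measurableSet_Ioc
          fun t ht => exp_neg_sin_sq_le hc.le ht
        exact (Continuous.integrableOn_Icc (by fun_prop)).mono_set Ioc_subset_Icc_self
    _ ≤ ∫ t, (exp (-(c * (4 / π ^ 2)) * t ^ 2)
      + exp (-(c * (4 / π ^ 2)) * (t - π) ^ 2) + exp (-(c * (4 / π ^ 2)) * (t + π) ^ 2)) :=
        setIntegral_le_integral ((i1.add i2).add i3) (ae_of_all _ fun t => by positivity)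
    _ = 3 * √(π / (c * (4 / π ^ 2))) := by
        have e1 := integral_add (i1.add i2) i3
        simp only [Pi.add_apply] at e1
        rw [e1, integral_add i1 i2,
          integral_sub_right_eq_self (fun t => exp (-(c * (4 / π ^ 2)) * t ^ 2)) π,
          integral_add_right_eq_self (fun t => exp (-(c * (4 / π ^ 2)) * t ^ 2)) π,
          integral_gaussian]
        ring

lemma abs_stepChar_le_exp {d : ℕ} (hd : 0 < d) (θ : Fin d → ℝ) :
    |stepChar d θ| ≤ exp (-∑ i, 1 / (2 * d) * sin (θ i) ^ 2) := by
  have hd' : (0 : ℝ) < d := by exact_mod_cast hd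
  have h1 : ∀ t : ℝ, |cos t| ≤ 1 - sin t ^ 2 / 2 := by
    intro t
    rw [← sqrt_sq_eq_abs, cos_sq']
    exact (sqrt_le_left (by nlinarith [sin_sq_le_one t])).2
      (by nlinarith [sin_sq_le_one t, sq_nonneg (sin t)])
  calc |stepChar d θ| ≤ 1 / d * ∑ i, |cos (θ i)| := abs_stepChar_le_avg d θ
    _ ≤ 1 / d * ∑ i, (1 - sin (θ i) ^ 2 / 2) := by gcongr with i; exact h1 _
    _ = (-∑ i, 1 / (2 * d) * sin (θ i) ^ 2) + 1 := by
        rw [Finset.sum_sub_distrib, ← Finset.mul_sum, ← Finset.sum_div]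
        simp only [Finset.sum_const, Finset.card_univ, Fintype.card_fin, nsmul_eq_mul, mul_one]
        field_simp; ring
    _ ≤ _ := add_one_le_exp _

lemma heatBound_le {d : ℕ} (hd : 3 ≤ d) :
    ∃ C : ℝ, 0 < C ∧ ∀ m : ℕ, 1 ≤ m → heatBound d m ≤ C * (m : ℝ) ^ (-(3 / 2) : ℝ) := by
  have hd0 : 0 < d := by omega
  have hd' : (0 : ℝ) < d := by exact_mod_cast hd0
  set K : ℝ := 3 * √(π * (2 * d) / (4 / π ^ 2)) with hK
  have hKpos : 0 < K := by positivity
  refine ⟨((2 * π) ^ d)⁻¹ * K ^ d, by positivity, fun m hm => ?_⟩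
  have hm' : (1 : ℝ) ≤ m := by exact_mod_cast hm
  have hm0 : (0 : ℝ) < m := by linarith
  rw [heatBound, mul_assoc]
  refine mul_le_mul_of_nonneg_left ?_ (by positivity)
  calc ∫ θ, |stepChar d θ| ^ m ∂(fourierCube d)
      ≤ ∫ θ : Fin d → ℝ, ∏ i, exp (-(m / (2 * d) * sin (θ i) ^ 2)) ∂(fourierCube d) := by
        refine integral_mono ?_ ?_ fun θ => ?_
        · refine integrable_fourierCube_of_bound ((continuous_stepChar d).abs.pow m) 1 fun θ => ?_
          rw [abs_pow, abs_abs]; exact pow_le_one₀ (abs_nonneg _) (abs_stepChar_le_one d θ)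
        · refine integrable_fourierCube_of_bound (by fun_prop) 1 fun θ => ?_
          rw [Finset.abs_prod]
          refine Finset.prod_le_one (fun _ _ => abs_nonneg _) fun i _ => ?_
          rw [abs_exp, exp_le_one_iff, neg_nonpos]
          positivity
        · refine (pow_le_pow_left₀ (abs_nonneg _) (abs_stepChar_le_exp hd0 θ) m).trans (le_of_eq ?_)
          rw [← exp_nat_mul, ← exp_sum, mul_neg, Finset.mul_sum, Finset.sum_neg_distrib]
          congr 2
          refine Finset.sum_congr rfl fun i _ => ?_
          ring
    _ = (∫ t in Ioc (-π) π, exp (-(m / (2 * d) * sin t ^ 2))) ^ d := by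
        have h := integral_fintype_prod_eq_pow (ι := Fin d)
          (μ := (volume : Measure ℝ).restrict (Ioc (-π) π))
          (fun t : ℝ => exp (-(m / (2 * d) * sin t ^ 2)))
        rw [Fintype.card_fin] at h
        exact h
    _ ≤ (K * (m : ℝ) ^ (-(1 / 2) : ℝ)) ^ d := by
        refine pow_le_pow_left₀ (integral_nonneg fun _ => (exp_pos _).le) ?_ d
        refine (integral_exp_neg_sin_sq_le (by positivity)).trans (le_of_eq ?_)
        rw [hK, rpow_neg hm0.le, ← sqrt_eq_rpow, mul_assoc, ← div_eq_mul_inv, ← sqrt_div' _ hm0.le]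
        congr 2
        field_simp
    _ ≤ K ^ d * (m : ℝ) ^ (-(3 / 2) : ℝ) := by
        rw [mul_pow]
        refine mul_le_mul_of_nonneg_left ?_ (by positivity)
        rw [← rpow_natCast, ← rpow_mul hm0.le]
        refine rpow_le_rpow_of_exponent_le hm' ?_
        have : (3 : ℝ) ≤ d := by exact_mod_cast hd
        linarith

lemma rwP_eq_zero_of_lt {d m : ℕ} {a b : Zd d} {i : Fin d} (h : m < (a i - b i).natAbs) :
    rwP d m a b = 0 := by
  induction m generalizing a with
  | zero =>
    simp only [rwP]
    refine if_neg ?_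
    rintro rfl
    simp at h
  | succ m ih =>
    simp only [rwP]
    rw [Finset.sum_eq_zero fun j _ => Finset.sum_eq_zero fun s _ => ih ?_, mul_zero]
    rw [rwStep]
    by_cases hj : i = j
    · subst hj
      rw [Function.update_self]
      cases s <;> simp <;> omega
    · rw [Function.update_of_ne hj]; omega

lemma rwP_eq_zero_of_lt_distInf {d m : ℕ} {a b : Zd d} (h : (m : ℝ) < distInf d a b) :
    rwP d m a b = 0 := by
  rw [distInf, Nat.cast_lt, Finset.lt_sup_iff] at h
  obtain ⟨i, -, hi⟩ := h
  exact rwP_eq_zero_of_lt hi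

lemma summable_rwP {d : ℕ} (hd : 3 ≤ d) (a b : Zd d) : Summable fun m => rwP d m a b := by
  obtain ⟨C, hC, h⟩ := heatBound_le hd
  rw [← summable_nat_add_iff 1]
  refine Summable.of_nonneg_of_le (fun m => rwP_nonneg _ _ _ _)
    (fun m => (rwP_le_heatBound (by omega) _ a b).trans (h (m + 1) (by omega))) ?_
  exact ((summable_nat_add_iff 1).2 (summable_nat_rpow.2 (by norm_num))).mul_left C

lemma green_self {d : ℕ} (hd : 3 ≤ d) (a : Zd d) : green d a a = green d 0 0 := by
  unfold green
  exact tsum_congr fun m => rwP_self (by omega) m a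

lemma green_decay {d : ℕ} (hd : 3 ≤ d) :
    ∃ C : ℝ, 0 < C ∧ ∀ (a b : Zd d) (r : ℝ), 0 < r → r ≤ distInf d a b →
      green d a b ≤ C * r ^ (-(1 / 4) : ℝ) := by
  obtain ⟨C, hC, h⟩ := heatBound_le hd
  have hs : Summable fun m : ℕ => (m : ℝ) ^ (-(5 / 4) : ℝ) := summable_nat_rpow.2 (by norm_num)
  refine ⟨C * ∑' m : ℕ, (m : ℝ) ^ (-(5 / 4) : ℝ), ?_, fun a b r hr hab => ?_⟩
  · refine mul_pos hC (hs.tsum_pos (fun m => by positivity) 1 (by norm_num))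
  rw [green, mul_right_comm, ← tsum_mul_left]
  refine Summable.tsum_le_tsum (fun m => ?_) (summable_rwP hd a b) (hs.mul_left _)
  rcases lt_or_ge (m : ℝ) r with hm | hm
  · rw [rwP_eq_zero_of_lt_distInf (hm.trans_le hab)]
    positivity
  · have hm0 : (0 : ℝ) < m := hr.trans_le hm
    refine (rwP_le_heatBound (by omega) m a b).trans
      ((h m (by exact_mod_cast hm0)).trans ?_)
    rw [mul_assoc]
    refine mul_le_mul_of_nonneg_left ?_ hC.le
    rw [show (-(3 / 2) : ℝ) = -(1 / 4) + -(5 / 4) by norm_num, rpow_add hm0]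
    refine mul_le_mul_of_nonneg_right ?_ (by positivity)
    exact rpow_le_rpow_of_nonpos hr hm (by norm_num)

lemma rwP_zero_add_one_le {d : ℕ} (hd : 0 < d) {a b : Zd d} (hab : a ≠ b) :
    rwP d 0 a b + rwP d 1 a b ≤ 1 / 2 := by
  have hd' : (0 : ℝ) < d := by exact_mod_cast hd
  have key : ∀ i, ∑ s : Bool, rwP d 0 (rwStep d i s a) b ≤ 1 := by
    intro i
    rw [Fintype.sum_bool]
    simp only [rwP]
    split_ifs with h1 h2 <;> norm_num
    have h3 := congrFun (h1.trans h2.symm) i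
    rw [rwStep, rwStep, Function.update_self, Function.update_self] at h3
    simp at h3
  have h0 : rwP d 0 a b = 0 := if_neg hab
  have h1 : rwP d 1 a b = (1 / (2 * d)) * ∑ i : Fin d, ∑ s : Bool, rwP d 0 (rwStep d i s a) b := rfl
  rw [h0, h1, zero_add]
  calc _ ≤ 1 / (2 * (d : ℝ)) * ∑ i : Fin d, (1 : ℝ) := by gcongr with i; exact key i
    _ = 1 / 2 := by simp; field_simp

lemma green_eq_tsum_pairs {d : ℕ} (hd : 3 ≤ d) (a b : Zd d) :
    HasSum (fun m => rwP d (2 * m) a b + rwP d (2 * m + 1) a b) (green d a b) := by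
  have hs := summable_rwP hd a b
  have he : Summable fun m => rwP d (2 * m) a b :=
    hs.comp_injective (mul_right_injective₀ two_ne_zero)
  have ho : Summable fun m => rwP d (2 * m + 1) a b :=
    hs.comp_injective ((add_left_injective 1).comp (mul_right_injective₀ two_ne_zero))
  rw [green, ← tsum_even_add_odd (f := fun m => rwP d m a b) he ho]
  exact he.hasSum.add ho.hasSum

lemma green_le_sub_half {d : ℕ} (hd : 3 ≤ d) {a b : Zd d} (hab : a ≠ b) :
    green d a b ≤ green d 0 0 - 1 / 2 := by
  have h1 := green_eq_tsum_pairs hd a b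
  have h2 := green_eq_tsum_pairs hd (0 : Zd d) 0
  rw [← hasSum_nat_add_iff' 1] at h1 h2
  have h3 := hasSum_le (fun m => rwP_even_add_odd_le (by omega) (m + 1) a b 0) h1 h2
  have h4 := rwP_zero_add_one_le (by omega) hab
  have h5 : 1 ≤ rwP d 0 (0 : Zd d) 0 + rwP d 1 (0 : Zd d) 0 := by
    have h6 : rwP d 0 (0 : Zd d) 0 = 1 := if_pos rfl
    linarith [rwP_nonneg d 1 0 0]
  simp only [Finset.range_one, Finset.sum_singleton, mul_zero, zero_add] at h3
  linarith

lemma half_le_green_zero {d : ℕ} (hd : 3 ≤ d) : 1 / 2 ≤ green d 0 0 := by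
  have := Summable.le_tsum (summable_rwP hd (0 : Zd d) 0) 0 fun m _ => rwP_nonneg d m 0 0
  have h6 : rwP d 0 (0 : Zd d) 0 = 1 := if_pos rfl
  rw [green]
  linarith

/-! ### Killed walks, Dirichlet Green's functions and harmonic measure -/

/-- Average of `f` over the nearest neighbours of `a`. -/
noncomputable def nbrAvg (d : ℕ) (f : Zd d → ℝ) (a : Zd d) : ℝ :=
  (1 / (2 * d)) * ∑ i : Fin d, ∑ s : Bool, f (rwStep d i s a)

section nbrAvg
variable {d : ℕ}

lemma nbrAvg_mono {f g : Zd d → ℝ} (h : ∀ a, f a ≤ g a) (a : Zd d) :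
    nbrAvg d f a ≤ nbrAvg d g a := by
  unfold nbrAvg
  gcongr with i _ s
  exact h _

lemma nbrAvg_nonneg {f : Zd d → ℝ} (h : ∀ a, 0 ≤ f a) (a : Zd d) : 0 ≤ nbrAvg d f a :=
  mul_nonneg (by positivity) (Finset.sum_nonneg fun _ _ => Finset.sum_nonneg fun _ _ => h _)

lemma nbrAvg_const (hd : 0 < d) (c : ℝ) (a : Zd d) : nbrAvg d (fun _ => c) a = c := by
  have : (0 : ℝ) < d := by exact_mod_cast hd
  simp [nbrAvg]
  field_simp

lemma nbrAvg_add (f g : Zd d → ℝ) (a : Zd d) :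
    nbrAvg d (fun x => f x + g x) a = nbrAvg d f a + nbrAvg d g a := by
  simp only [nbrAvg, Finset.sum_add_distrib, mul_add]

lemma nbrAvg_sub (f g : Zd d → ℝ) (a : Zd d) :
    nbrAvg d (fun x => f x - g x) a = nbrAvg d f a - nbrAvg d g a := by
  simp only [nbrAvg, Finset.sum_sub_distrib, mul_sub]

lemma nbrAvg_mul_right (f : Zd d → ℝ) (c : ℝ) (a : Zd d) :
    nbrAvg d (fun x => f x * c) a = nbrAvg d f a * c := by
  simp only [nbrAvg, ← Finset.sum_mul, mul_assoc]

lemma nbrAvg_sum {ι : Type*} (s : Finset ι) (f : ι → Zd d → ℝ) (a : Zd d) :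
    nbrAvg d (fun x => ∑ j ∈ s, f j x) a = ∑ j ∈ s, nbrAvg d (f j) a := by
  classical
  induction s using Finset.induction_on with
  | empty => simp [nbrAvg]
  | insert j s hj ih => simp only [Finset.sum_insert hj, nbrAvg_add, ih]

lemma nbrAvg_comm (F : Zd d → Zd d → ℝ) (a b : Zd d) :
    nbrAvg d (fun x => nbrAvg d (F x) b) a = nbrAvg d (fun y => nbrAvg d (fun x => F x y) a) b := by
  change nbrAvg d (fun x => (1 / (2 * d)) * ∑ i : Fin d, ∑ s : Bool, F x (rwStep d i s b)) a
    = (1 / (2 * d)) * ∑ i : Fin d, ∑ s : Bool, nbrAvg d (fun x => F x (rwStep d i s b)) a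
  simp_rw [mul_comm (1 / (2 * (d : ℝ))), nbrAvg_mul_right, nbrAvg_sum]

lemma hasSum_nbrAvg {f : ℕ → Zd d → ℝ} {g : Zd d → ℝ} (h : ∀ a, HasSum (fun m => f m a) (g a))
    (a : Zd d) : HasSum (fun m => nbrAvg d (f m) a) (nbrAvg d g a) :=
  (hasSum_sum fun _ _ => hasSum_sum fun _ _ => h _).mul_left _

/-- The maximum principle for subharmonic functions on a finite set. -/
lemma nonpos_of_subharmonic (hd : 0 < d) {U : Finset (Zd d)} {f : Zd d → ℝ}
    (hU : ∀ a ∈ U, f a ≤ nbrAvg d f a) (h0 : ∀ a ∉ U, f a ≤ 0) (a : Zd d) : f a ≤ 0 := by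
  by_contra! ha
  have haU : a ∈ U := by by_contra h; exact absurd (h0 a h) (not_le.2 ha)
  obtain ⟨x, hxU, hx⟩ := U.exists_max_image f ⟨a, haU⟩
  obtain ⟨y, hy, hymax⟩ := (U.filter fun z => f z = f x).exists_max_image
    (fun z => z ⟨0, hd⟩) ⟨x, by simp [hxU]⟩
  rw [Finset.mem_filter] at hy
  have hpos : 0 < f x := ha.trans_le (hx a haU)
  have hle : ∀ z, f z ≤ f x := fun z => by
    by_cases hz : z ∈ U
    · exact hx z hz
    · exact (h0 z hz).trans hpos.le
  have hs : ∑ i : Fin d, ∑ s : Bool, (f x - f (rwStep d i s y)) ≤ 0 := by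
    have h1 := hU y hy.1
    rw [hy.2, nbrAvg, one_div, ← div_eq_inv_mul, le_div_iff₀ (by positivity)] at h1
    simp only [Finset.sum_sub_distrib, Finset.sum_const, Finset.card_univ, Fintype.card_bool,
      Fintype.card_fin, nsmul_eq_mul, Nat.cast_ofNat]
    linarith
  have h2 : f x - f (rwStep d ⟨0, hd⟩ true y) ≤ 0 :=
    ((Finset.single_le_sum (f := fun s => f x - f (rwStep d ⟨0, hd⟩ s y))
      (fun s _ => sub_nonneg.2 (hle _)) (Finset.mem_univ true)).trans
      (Finset.single_le_sum (f := fun i => ∑ s : Bool, (f x - f (rwStep d i s y)))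
        (fun i _ => Finset.sum_nonneg fun s _ => sub_nonneg.2 (hle _))
        (Finset.mem_univ (⟨0, hd⟩ : Fin d)))).trans hs
  have h3 : f (rwStep d ⟨0, hd⟩ true y) = f x := le_antisymm (hle _) (by linarith)
  have h4 : rwStep d ⟨0, hd⟩ true y ∈ U := by
    by_contra h
    linarith [h0 _ h]
  have h5 := hymax _ (Finset.mem_filter.2 ⟨h4, h3⟩)
  simp [rwStep] at h5

lemma eq_zero_of_harmonic (hd : 0 < d) {U : Finset (Zd d)} {f : Zd d → ℝ}
    (hU : ∀ a ∈ U, f a = nbrAvg d f a) (h0 : ∀ a ∉ U, f a = 0) (a : Zd d) : f a = 0 := by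
  refine le_antisymm (nonpos_of_subharmonic hd (fun a ha => (hU a ha).le) (fun a ha => (h0 a ha).le)
    a) ?_
  have hneg : ∀ x, nbrAvg d (fun x => -f x) x = -nbrAvg d f x := fun x => by
    simpa [nbrAvg] using nbrAvg_sub (fun _ => 0) f x
  have := nonpos_of_subharmonic hd (U := U) (f := fun x => -f x)
    (fun a ha => by rw [hneg, ← hU a ha]) (fun a ha => by rw [h0 a ha, neg_zero]) a
  linarith

end nbrAvg

section killed
variable {d : ℕ} {Λ : Set (Zd d)}

lemma rwPIn_of_notMem {m : ℕ} {a : Zd d} (ha : a ∉ Λ) (b : Zd d) : rwPIn d Λ m a b = 0 := by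
  cases m <;> simp [rwPIn, ha]

lemma rwPIn_succ {m : ℕ} {a : Zd d} (ha : a ∈ Λ) (b : Zd d) :
    rwPIn d Λ (m + 1) a b = nbrAvg d (fun x => rwPIn d Λ m x b) a := by
  simp [rwPIn, ha, nbrAvg]

lemma rwP_succ (m : ℕ) (a b : Zd d) : rwP d (m + 1) a b = nbrAvg d (fun x => rwP d m x b) a := rfl

lemma rwPIn_nonneg (m : ℕ) (a b : Zd d) : 0 ≤ rwPIn d Λ m a b := by
  induction m generalizing a with
  | zero => simp only [rwPIn]; split_ifs <;> norm_num
  | succ m ih =>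
    by_cases ha : a ∈ Λ
    · rw [rwPIn_succ ha]; exact nbrAvg_nonneg ih a
    · rw [rwPIn_of_notMem ha]

lemma rwPIn_le_rwP (m : ℕ) (a b : Zd d) : rwPIn d Λ m a b ≤ rwP d m a b := by
  induction m generalizing a with
  | zero => simp only [rwPIn, rwP]; split_ifs <;> simp_all
  | succ m ih =>
    by_cases ha : a ∈ Λ
    · rw [rwPIn_succ ha, rwP_succ]; exact nbrAvg_mono ih a
    · rw [rwPIn_of_notMem ha]; exact rwP_nonneg _ _ _ _

lemma summable_rwPIn (hd : 3 ≤ d) (a b : Zd d) : Summable fun m => rwPIn d Λ m a b :=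
  Summable.of_nonneg_of_le (fun m => rwPIn_nonneg m a b) (fun m => rwPIn_le_rwP m a b)
    (summable_rwP hd a b)

lemma greenIn_nonneg (a b : Zd d) : 0 ≤ greenIn d Λ a b := tsum_nonneg fun m => rwPIn_nonneg m a b

lemma greenIn_le_green (hd : 3 ≤ d) (a b : Zd d) : greenIn d Λ a b ≤ green d a b :=
  Summable.tsum_le_tsum (fun m => rwPIn_le_rwP m a b) (summable_rwPIn hd a b) (summable_rwP hd a b)

lemma greenIn_of_notMem {a : Zd d} (ha : a ∉ Λ) (b : Zd d) : greenIn d Λ a b = 0 := by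
  simp [greenIn, rwPIn_of_notMem ha]

lemma greenIn_eq_nbrAvg (hd : 3 ≤ d) {a b : Zd d} (ha : a ∈ Λ) (hab : a ≠ b) :
    greenIn d Λ a b = nbrAvg d (fun x => greenIn d Λ x b) a := by
  rw [greenIn, (summable_rwPIn hd a b).tsum_eq_zero_add]
  have h0 : rwPIn d Λ 0 a b = 0 := if_neg fun h => hab h.1
  rw [h0, zero_add]
  simp_rw [rwPIn_succ ha]
  exact (hasSum_nbrAvg (fun x => (summable_rwPIn hd x b).hasSum) a).tsum_eq

/-- Removing the killing increases the Green's function at most by its values off `Λ`. -/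
lemma green_le_greenIn_add (hd : 3 ≤ d) {b : Zd d} {K : ℝ} (hK : ∀ c ∉ Λ, green d c b ≤ K)
    (hK0 : 0 ≤ K) (a : Zd d) : green d a b ≤ greenIn d Λ a b + K := by
  have hpart : ∀ (M : ℕ) (a : Zd d), ∑ m ∈ Finset.range M, rwP d m a b
      ≤ ∑ m ∈ Finset.range M, rwPIn d Λ m a b + K := by
    intro M
    induction M with
    | zero => intro a; simpa using hK0
    | succ M ih =>
      intro a
      by_cases ha : a ∈ Λ
      · rw [Finset.sum_range_succ', Finset.sum_range_succ']
        simp_rw [rwPIn_succ ha, rwP_succ, ← nbrAvg_sum]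
        have h0 : rwPIn d Λ 0 a b = rwP d 0 a b := by simp [rwPIn, rwP, ha]
        have h1 := nbrAvg_mono ih a
        rw [nbrAvg_add, nbrAvg_const (by omega)] at h1
        linarith
      · have h1 : ∑ m ∈ Finset.range (M + 1), rwP d m a b ≤ green d a b :=
          (summable_rwP hd a b).sum_le_tsum _ fun m _ => rwP_nonneg d m a b
        have h2 : 0 ≤ ∑ m ∈ Finset.range (M + 1), rwPIn d Λ m a b :=
          Finset.sum_nonneg fun m _ => rwPIn_nonneg m a b
        linarith [hK a ha]
  refine le_of_tendsto_of_tendsto' (summable_rwP hd a b).hasSum.tendsto_sum_nat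
    ((summable_rwPIn hd a b).hasSum.tendsto_sum_nat.add_const K) fun M => hpart M a

lemma rwStep_eq_iff {i : Fin d} {s : Bool} {a b : Zd d} :
    rwStep d i s a = b ↔ a = rwStep d i (!s) b := by
  constructor <;> rintro rfl <;> ext j <;> by_cases h : j = i <;> cases s <;> simp [rwStep, h]

lemma rwPIn_succ_last (m : ℕ) {a b : Zd d} (hb : b ∈ Λ) :
    rwPIn d Λ (m + 1) a b = nbrAvg d (fun y => rwPIn d Λ m a y) b := by
  induction m generalizing a with
  | zero =>
    by_cases ha : a ∈ Λ
    · rw [rwPIn_succ ha]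
      unfold nbrAvg
      congr 1
      refine Finset.sum_congr rfl fun i _ => ?_
      rw [Fintype.sum_bool, Fintype.sum_bool, add_comm]
      have key : ∀ s, rwPIn d Λ 0 (rwStep d i s a) b = rwPIn d Λ 0 a (rwStep d i (!s) b) := by
        intro s
        simp only [rwPIn, ← rwStep_eq_iff, ha, and_true]
        by_cases h : rwStep d i s a = b <;> simp [h, hb]
      simp only [key]
      rfl
    · simp [rwPIn_of_notMem ha, nbrAvg]
  | succ m ih =>
    by_cases ha : a ∈ Λ
    · rw [rwPIn_succ ha]
      simp_rw [ih, rwPIn_succ ha]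
      exact nbrAvg_comm _ a b
    · simp [rwPIn_of_notMem ha, nbrAvg]

lemma rwPIn_symm (m : ℕ) (a b : Zd d) : rwPIn d Λ m a b = rwPIn d Λ m b a := by
  induction m generalizing a b with
  | zero =>
    rcases eq_or_ne a b with rfl | h
    · rfl
    · simp [rwPIn, h, h.symm]
  | succ m ih =>
    by_cases hb : b ∈ Λ
    · rw [rwPIn_succ_last m hb, rwPIn_succ hb]
      simp_rw [ih a]
    · have key : ∀ m x, rwPIn d Λ m x b = 0 := by
        intro m
        induction m with
        | zero => intro x; simp only [rwPIn, ite_eq_right_iff, one_ne_zero, imp_false]; rintro ⟨rfl, h⟩; exact hb h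
        | succ m ih =>
          intro x
          by_cases hx : x ∈ Λ
          · simp [rwPIn_succ hx, ih, nbrAvg]
          · exact rwPIn_of_notMem hx b
      rw [key, rwPIn_of_notMem hb]

lemma greenIn_symm (a b : Zd d) : greenIn d Λ a b = greenIn d Λ b a :=
  tsum_congr fun m => rwPIn_symm m a b

lemma hitPIn_nonneg {F : Set (Zd d)} (m : ℕ) (a b : Zd d) : 0 ≤ hitPIn d Λ F m a b := by
  induction m generalizing a with
  | zero => simp only [hitPIn]; split_ifs <;> norm_num
  | succ m ih =>
    simp only [hitPIn]
    split_ifs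
    · exact nbrAvg_nonneg ih a
    · exact le_rfl

lemma sum_hitPIn_le_one (hd : 0 < d) (F : Finset (Zd d)) (M : ℕ) (a : Zd d) :
    ∑ m ∈ Finset.range M, ∑ b ∈ F, hitPIn d Λ F m a b ≤ 1 := by
  classical
  induction M generalizing a with
  | zero => simp
  | succ M ih =>
    rw [Finset.sum_range_succ']
    by_cases haF : a ∈ F
    · have h1 : ∀ m b, hitPIn d Λ F (m + 1) a b = 0 := fun m b => by
        simp [hitPIn, haF]
      simp only [h1, Finset.sum_const_zero, zero_add]
      calc ∑ b ∈ F, hitPIn d Λ F 0 a b ≤ ∑ b ∈ F, if a = b then 1 else 0 := by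
            refine Finset.sum_le_sum fun b _ => ?_
            simp only [hitPIn]
            split_ifs
            all_goals simp_all
        _ ≤ 1 := by rw [Finset.sum_ite_eq]; split_ifs; norm_num
    · have h0 : ∀ b ∈ F, hitPIn d Λ F 0 a b = 0 := fun b hb => by
        have hne : a ≠ b := fun e => haF (e ▸ hb)
        simp [hitPIn, hne]
      rw [Finset.sum_eq_zero h0, add_zero]
      by_cases haΛ : a ∈ Λ
      · have h1 : ∀ m b, hitPIn d Λ F (m + 1) a b = nbrAvg d (fun x => hitPIn d Λ F m x b) a :=
          fun m b => by simp [hitPIn, haF, haΛ, nbrAvg]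
        simp_rw [h1, ← nbrAvg_sum]
        exact (nbrAvg_mono ih a).trans_eq (nbrAvg_const hd 1 a)
      · simp [hitPIn, haΛ]

lemma summable_hitPIn (hd : 0 < d) (F : Finset (Zd d)) (a : Zd d) {b : Zd d} (hb : b ∈ F) :
    Summable fun m => hitPIn d Λ F m a b :=
  summable_of_sum_range_le (c := 1) (fun m => hitPIn_nonneg m a b) fun M =>
    (Finset.sum_le_sum fun m _ => Finset.single_le_sum (f := fun b => hitPIn d Λ F m a b)
      (fun b _ => hitPIn_nonneg m a b) hb).trans (sum_hitPIn_le_one hd F M a)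

lemma hitMeasIn_nonneg {F : Set (Zd d)} (a b : Zd d) : 0 ≤ hitMeasIn d Λ F a b :=
  tsum_nonneg fun m => hitPIn_nonneg m a b

lemma sum_hitMeasIn_le_one (hd : 0 < d) (F : Finset (Zd d)) (a : Zd d) :
    ∑ b ∈ F, hitMeasIn d Λ F a b ≤ 1 := by
  have h := hasSum_sum fun b (hb : b ∈ F) => (summable_hitPIn (Λ := Λ) hd F a hb).hasSum
  exact le_of_tendsto' h.tendsto_sum_nat fun M => sum_hitPIn_le_one hd F M a

/-- The strong Markov property at the hitting time of `F`, for the Dirichlet Green's function. -/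
lemma greenIn_eq_sum_hitMeasIn (hd : 3 ≤ d) {V F : Finset (Zd d)} (hFV : F ⊆ V) {b : Zd d}
    (hb : b ∈ F) (a : Zd d) :
    greenIn d V a b = ∑ j ∈ F, hitMeasIn d V F a j * greenIn d V j b := by
  classical
  have hd0 : 0 < d := by omega
  have hF : ∀ x ∈ F, ∀ j ∈ F, hitMeasIn d V F x j = if x = j then 1 else 0 := by
    intro x hx j hj
    rw [hitMeasIn, tsum_eq_single 0 fun m hm => ?_]
    · simp only [hitPIn]
      by_cases h : x = j <;> simp [h, hj, hFV hj]
    · obtain ⟨m, rfl⟩ := Nat.exists_eq_succ_of_ne_zero hm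
      simp [hitPIn, hx]
  have hout : ∀ x ∉ V, ∀ j, hitMeasIn d V F x j = 0 := by
    intro x hx j
    rw [hitMeasIn, ← tsum_zero (α := ℝ) (β := ℕ)]
    refine tsum_congr fun m => ?_
    cases m with
    | zero => simp only [hitPIn, ite_eq_right_iff, one_ne_zero, imp_false]; rintro ⟨rfl, -, h⟩; exact hx h
    | succ m => simp [hitPIn, hx]
  have havg : ∀ x ∈ V \ F, ∀ j ∈ F,
      hitMeasIn d V F x j = nbrAvg d (fun y => hitMeasIn d V F y j) x := by
    intro x hx j hj
    rw [Finset.mem_sdiff] at hx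
    rw [hitMeasIn, (summable_hitPIn hd0 F x hj).tsum_eq_zero_add]
    have h0 : hitPIn d (V : Set (Zd d)) F 0 x j = 0 := by
      have hne : x ≠ j := fun e => hx.2 (e ▸ hj)
      simp [hitPIn, hne]
    have h1 : ∀ m, hitPIn d (V : Set (Zd d)) F (m + 1) x j
        = nbrAvg d (fun y => hitPIn d V F m y j) x := fun m => by
      simp [hitPIn, hx, nbrAvg]
    simp_rw [h0, h1, zero_add]
    exact (hasSum_nbrAvg (fun y => (summable_hitPIn hd0 F y hj).hasSum) x).tsum_eq
  refine sub_eq_zero.1 (eq_zero_of_harmonic hd0 (U := V \ F)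
    (f := fun x => greenIn d V x b - ∑ j ∈ F, hitMeasIn d V F x j * greenIn d V j b) ?_ ?_ a)
  · intro x hx
    rw [nbrAvg_sub, nbrAvg_sum]
    simp_rw [nbrAvg_mul_right]
    have hx' := Finset.mem_sdiff.1 hx
    rw [← greenIn_eq_nbrAvg hd hx'.1 (fun h => hx'.2 (h ▸ hb))]
    congr 1
    exact Finset.sum_congr rfl fun j hj => by rw [← havg x hx j hj]
  · intro x hx
    by_cases hxF : x ∈ F
    · rw [Finset.sum_congr rfl fun j hj => by rw [hF x hxF j hj]]
      simp [hxF]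
    · have hxV : x ∉ V := fun h => hx (Finset.mem_sdiff.2 ⟨h, hxF⟩)
      rw [greenIn_of_notMem (by simpa using hxV)]
      simp [hout x hxV]

end killed

section Avoidance

variable {Ω ι : Type*} [MeasurableSpace Ω] {P : Measure Ω} [IsProbabilityMeasure P]

lemma measureReal_inter_iInter_sub_le (A : ι → Set Ω)
    {F S : Finset ι} (hFS : F ⊆ S) (E : Set Ω) [DecidableEq ι] :
    P.real (E ∩ ⋂ j ∈ S, (A j)ᶜ) ≤ P.real (E ∩ ⋂ j ∈ F, (A j)ᶜ) ∧
    P.real (E ∩ ⋂ j ∈ F, (A j)ᶜ) ≤ P.real (E ∩ ⋂ j ∈ S, (A j)ᶜ)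
      + ∑ j ∈ S \ F, P.real (E ∩ A j) := by
  refine ⟨measureReal_mono (inter_subset_inter_right _ (biInter_subset_biInter_left hFS)), ?_⟩
  have hsub : E ∩ ⋂ j ∈ F, (A j)ᶜ ⊆ (E ∩ ⋂ j ∈ S, (A j)ᶜ) ∪ ⋃ j ∈ S \ F, E ∩ A j := by
    rintro ω ⟨hE, hω⟩
    simp only [mem_iInter, mem_compl_iff] at hω
    by_cases h : ∃ j ∈ S, ω ∈ A j
    · obtain ⟨j, hj, hjA⟩ := h
      refine Or.inr (mem_biUnion (x := j) ?_ ⟨hE, hjA⟩)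
      exact Finset.mem_sdiff.2 ⟨hj, fun hF => hω j hF hjA⟩
    · push Not at h
      exact Or.inl ⟨hE, by simpa using h⟩
  calc P.real (E ∩ ⋂ j ∈ F, (A j)ᶜ)
      ≤ P.real ((E ∩ ⋂ j ∈ S, (A j)ᶜ) ∪ ⋃ j ∈ S \ F, E ∩ A j) := measureReal_mono hsub
    _ ≤ P.real (E ∩ ⋂ j ∈ S, (A j)ᶜ) + P.real (⋃ j ∈ S \ F, E ∩ A j) :=
        measureReal_union_le _ _
    _ ≤ _ := by gcongr; exact measureReal_biUnion_finset_le _ _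

/-- Poisson approximation for avoidance probabilities of weakly dependent events. -/
lemma abs_measureReal_avoid_sub_exp_le (A : ι → Set Ω) (hA : ∀ i, MeasurableSet (A i))
    (near : ι → ι → Prop) [DecidableRel near] [DecidableEq ι] (c : ι → ℝ) (S : Finset ι)
    (hc : ∀ i ∈ S, ∀ F ⊆ S, i ∉ F → (∀ j ∈ F, ¬ near i j) →
      |P.real (A i ∩ ⋂ j ∈ F, (A j)ᶜ) - P.real (A i) * P.real (⋂ j ∈ F, (A j)ᶜ)| ≤ c i) :
    |P.real (⋂ j ∈ S, (A j)ᶜ) - exp (-∑ i ∈ S, P.real (A i))| ≤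
      ∑ i ∈ S, (c i + P.real (A i) ^ 2 + ∑ j ∈ S with near i j ∧ j ≠ i,
        (P.real (A i ∩ A j) + P.real (A i) * P.real (A j))) := by
  induction S using Finset.induction_on with
  | empty => simp
  | insert i S hi ih =>
    have ih' := ih fun i' hi' F hF => hc i' (Finset.mem_insert_of_mem hi') F
      (hF.trans (Finset.subset_insert _ _))
    set p := P.real (A i)
    set Q := P.real (⋂ j ∈ S, (A j)ᶜ)
    set σ := ∑ j ∈ S, P.real (A j)
    have hp0 : 0 ≤ p := measureReal_nonneg
    have hp1 : p ≤ 1 := measureReal_le_one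
    have hQ0 : 0 ≤ Q := measureReal_nonneg
    have hQ1 : Q ≤ 1 := measureReal_le_one
    have hQ' : P.real (⋂ j ∈ insert i S, (A j)ᶜ) = Q - P.real (A i ∩ ⋂ j ∈ S, (A j)ᶜ) := by
      have := measureReal_inter_add_sdiff (μ := P) (s := ⋂ j ∈ S, (A j)ᶜ) (hA i)
      have h2 : (⋂ j ∈ insert i S, (A j)ᶜ) = (⋂ j ∈ S, (A j)ᶜ) \ A i := by
        rw [Finset.set_biInter_insert, inter_comm, sdiff_eq]
      rw [h2, inter_comm (A i)]
      linarith
    set T : Finset ι := S.filter fun j => near i j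
    set F : Finset ι := S.filter fun j => ¬ near i j
    have hFS : F ⊆ S := Finset.filter_subset _ _
    have hSF : S \ F = T := by
      ext j; simp only [F, T, Finset.mem_sdiff, Finset.mem_filter]; tauto
    have h1 := measureReal_inter_iInter_sub_le (P := P) A hFS (A i)
    have h2 := measureReal_inter_iInter_sub_le (P := P) A hFS univ
    simp only [univ_inter, hSF] at h1 h2
    have h3 := hc i (Finset.mem_insert_self i S) F (hFS.trans (Finset.subset_insert _ _))
      (fun h => hi (hFS h)) (fun j hj => (Finset.mem_filter.1 hj).2)
    have hexp : |1 - p - exp (-p)| ≤ p ^ 2 := by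
      have := Real.abs_exp_sub_one_sub_id_le (x := -p) (by rw [abs_neg, abs_of_nonneg hp0]; exact hp1)
      rw [abs_sub_comm, ← neg_sq]
      convert this using 2
      ring
    have hnear : ∑ j ∈ insert i S with near i j ∧ j ≠ i,
        (P.real (A i ∩ A j) + p * P.real (A j))
        = ∑ j ∈ T, P.real (A i ∩ A j) + p * ∑ j ∈ T, P.real (A j) := by
      have : (insert i S).filter (fun j => near i j ∧ j ≠ i) = T := by
        ext j
        simp only [T, Finset.mem_filter, Finset.mem_insert]
        constructor
        · rintro ⟨h | h, h', h''⟩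
          · exact absurd h h''
          · exact ⟨h, h'⟩
        · rintro ⟨h, h'⟩
          exact ⟨Or.inr h, h', fun e => hi (e ▸ h)⟩
      rw [this, Finset.sum_add_distrib, Finset.mul_sum]
    have hmono : ∑ i' ∈ S, (c i' + P.real (A i') ^ 2 + ∑ j ∈ S with near i' j ∧ j ≠ i',
        (P.real (A i' ∩ A j) + P.real (A i') * P.real (A j))) ≤
        ∑ i' ∈ S, (c i' + P.real (A i') ^ 2 + ∑ j ∈ insert i S with near i' j ∧ j ≠ i',
        (P.real (A i' ∩ A j) + P.real (A i') * P.real (A j))) := by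
      refine Finset.sum_le_sum fun i' _ => ?_
      gcongr
      exact Finset.subset_insert _ _
    rw [Finset.sum_insert hi, Finset.sum_insert hi, hnear, hQ']
    have hstep : |Q - P.real (A i ∩ ⋂ j ∈ S, (A j)ᶜ) - exp (-p) * Q| ≤
        c i + p ^ 2 + (∑ j ∈ T, P.real (A i ∩ A j) + p * ∑ j ∈ T, P.real (A j)) := by
      have e1 : |(1 - p - exp (-p)) * Q| ≤ p ^ 2 := by
        rw [abs_mul, abs_of_nonneg hQ0]
        exact (mul_le_mul hexp hQ1 hQ0 (sq_nonneg _)).trans_eq (mul_one _)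
      have h4 := mul_le_mul_of_nonneg_left h2.1 hp0
      have h5 := mul_le_mul_of_nonneg_left h2.2 hp0
      rw [mul_add] at h5
      rw [abs_le] at e1 h3 ⊢
      constructor <;> nlinarith
    have hexpσ : exp (-(p + σ)) = exp (-p) * exp (-σ) := by rw [← exp_add]; ring_nf
    rw [hexpσ]
    have e2 : |exp (-p) * (Q - exp (-σ))| ≤ |Q - exp (-σ)| := by
      rw [abs_mul, abs_of_pos (exp_pos _)]
      exact mul_le_of_le_one_left (abs_nonneg _) (exp_le_one_iff.2 (by linarith))
    have e3 := abs_add_le (Q - P.real (A i ∩ ⋂ j ∈ S, (A j)ᶜ) - exp (-p) * Q)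
      (exp (-p) * (Q - exp (-σ)))
    rw [show Q - P.real (A i ∩ ⋂ j ∈ S, (A j)ᶜ) - exp (-p) * exp (-σ)
      = (Q - P.real (A i ∩ ⋂ j ∈ S, (A j)ᶜ) - exp (-p) * Q) + exp (-p) * (Q - exp (-σ)) by ring]
    linarith

end Avoidance

section GaussianField

variable {Ω : Type*} [MeasurableSpace Ω] {P : Measure Ω} {d : ℕ} {G : Zd d → Zd d → ℝ}
  {φ : Zd d → Ω → ℝ}

lemma IsGaussianField.map_sum (hφ : IsGaussianField P d G φ) (c : Zd d → ℝ) (F : Finset (Zd d)) :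
    P.map (fun ω => ∑ a ∈ F, c a * φ a ω) =
      gaussianReal 0 (Real.toNNReal (∑ a ∈ F, ∑ b ∈ F, c a * c b * G a b)) := by
  classical
  let c' : Zd d →₀ ℝ := Finsupp.onFinset F (fun a => if a ∈ F then c a else 0) (by
    intro a h; by_contra h'; simp [h'] at h)
  have hc' : ∀ a ∈ F, c' a = c a := fun a ha => by simp [c', ha]
  have hsub : c'.support ⊆ F := Finsupp.support_onFinset_subset
  have hz : ∀ a, a ∉ c'.support → c' a = 0 := fun a h => by simpa using h
  have h1 : ∀ f : Zd d → ℝ, ∑ a ∈ c'.support, c' a * f a = ∑ a ∈ F, c a * f a := by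
    intro f
    rw [Finset.sum_subset hsub fun a _ h => by rw [hz a h, zero_mul]]
    exact Finset.sum_congr rfl fun a ha => by rw [hc' a ha]
  have h2 := hφ.2 c'
  simp_rw [mul_assoc, ← Finset.mul_sum, h1] at h2 ⊢
  exact h2

lemma IsGaussianField.isGaussianProcess (hφ : IsGaussianField P d G φ) :
    IsGaussianProcess φ P where
  hasGaussianLaw I := by
    refine ⟨isGaussian_of_map_eq_gaussianReal fun L => ?_⟩
    classical
    let c : Zd d → ℝ := fun a => if h : a ∈ I then L (Pi.single ⟨a, h⟩ 1) else 0
    have hL : ∀ x : I → ℝ, L x = ∑ i : I, x i * L (Pi.single i 1) := fun x => by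
      conv_lhs => rw [← Finset.univ_sum_single x]
      rw [_root_.map_sum]
      refine Finset.sum_congr rfl fun i _ => ?_
      have : (Pi.single i (x i) : I → ℝ) = x i • Pi.single i 1 := by
        rw [← Pi.single_smul]; simp
      rw [this, map_smul, smul_eq_mul]
    refine ⟨0, _, Eq.trans ?_ (hφ.map_sum c I)⟩
    have hmeas : Measurable fun ω => I.restrict (φ · ω) := measurable_pi_iff.2 fun i => hφ.1 i
    rw [Measure.map_map L.continuous.measurable hmeas]
    congr 1
    ext ω
    rw [Function.comp_apply, hL, ← Finset.sum_coe_sort I]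
    exact Finset.sum_congr rfl fun i _ => by simp [c, mul_comm]

lemma IsGaussianField.map_eval (hφ : IsGaussianField P d G φ) (a : Zd d) :
    P.map (φ a) = gaussianReal 0 (Real.toNNReal (G a a)) := by
  simpa using hφ.map_sum 1 {a}

lemma IsGaussianField.map_add (hφ : IsGaussianField P d G φ) {a b : Zd d} (hab : a ≠ b) :
    P.map (fun ω => φ a ω + φ b ω) =
      gaussianReal 0 (Real.toNNReal (G a a + G a b + (G b a + G b b))) := by
  classical
  simpa [Finset.sum_pair hab] using hφ.map_sum 1 {a, b}

lemma variance_eq_of_map_eq_gaussianReal {X : Ω → ℝ} (hX : AEMeasurable X P) {v : NNReal}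
    (h : P.map X = gaussianReal 0 v) : Var[X; P] = v := by
  have := variance_map (X := id) (Y := X) (μ := P) aemeasurable_id hX
  rw [h, variance_id_gaussianReal] at this
  simpa using this.symm

lemma IsGaussianField.covariance_eq (hφ : IsGaussianField P d G φ) (hG0 : ∀ a b, 0 ≤ G a b)
    (hG : ∀ a b, G a b = G b a) (a b : Zd d) : cov[φ a, φ b; P] = G a b := by
  have hP : IsProbabilityMeasure P := hφ.isGaussianProcess.isProbabilityMeasure
  have hm : ∀ a, MemLp (φ a) 2 P := fun a =>
    (hφ.isGaussianProcess.hasGaussianLaw_eval a).memLp_two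
  have hv : ∀ a, Var[φ a; P] = G a a := fun a => by
    rw [variance_eq_of_map_eq_gaussianReal (hφ.1 a).aemeasurable (hφ.map_eval a),
      Real.coe_toNNReal _ (hG0 _ _)]
  rcases eq_or_ne a b with rfl | hab
  · rw [covariance_self (hφ.1 a).aemeasurable, hv]
  · have h := variance_eq_of_map_eq_gaussianReal ((hφ.1 a).add (hφ.1 b)).aemeasurable
      (hφ.map_add hab)
    rw [Real.coe_toNNReal _ (by have := hG0 a a; have := hG0 a b; have := hG0 b a
                                have := hG0 b b; positivity),
      variance_add (hm a) (hm b), hv, hv, hG b a] at h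
    linarith

/-- The Markov decomposition of the zero-boundary field: off a small perturbation, the value at
`a` is independent of the field on `F`. -/
lemma IsGaussianField.exists_decomposition (hd : 3 ≤ d) {V F : Finset (Zd d)} (hFV : F ⊆ V)
    (hφ : IsGaussianField P d (greenIn d (V : Set (Zd d))) φ) (a : Zd d) {K : ℝ} (hK : 0 ≤ K)
    (haF : ∀ j ∈ F, green d a j ≤ K) :
    ∃ (L : Ω → ℝ) (v : NNReal), Measurable L ∧ P.map L = gaussianReal 0 v ∧ v ≤ K ∧
      IndepFun (fun ω => φ a ω - L ω) (fun ω (j : F) => φ j ω) P := by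
  classical
  have hP : IsProbabilityMeasure P := hφ.isGaussianProcess.isProbabilityMeasure
  set h := fun j => hitMeasIn d V F a j
  have hh0 : ∀ j, 0 ≤ h j := fun j => hitMeasIn_nonneg a j
  have hcov := hφ.covariance_eq (fun a b => greenIn_nonneg a b) (fun a b => greenIn_symm a b)
  have hm : ∀ a, MemLp (φ a) 2 P := fun a =>
    (hφ.isGaussianProcess.hasGaussianLaw_eval a).memLp_two
  have hhm : ∀ j, MemLp (fun ω => h j * φ j ω) 2 P := fun j => (hm j).const_mul _
  refine ⟨fun ω => ∑ j ∈ F, h j * φ j ω, _, ?_, hφ.map_sum h F, ?_, ?_⟩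
  · exact Finset.measurable_sum _ fun j _ => (hφ.1 j).const_mul _
  · rw [Real.coe_toNNReal']
    refine max_le ?_ hK
    calc ∑ j ∈ F, ∑ l ∈ F, h j * h l * greenIn d V j l
        = ∑ l ∈ F, h l * greenIn d V a l := by
          rw [Finset.sum_comm]
          refine Finset.sum_congr rfl fun l hl => ?_
          rw [greenIn_eq_sum_hitMeasIn hd hFV hl a, Finset.mul_sum]
          exact Finset.sum_congr rfl fun j _ => by ring
      _ ≤ ∑ l ∈ F, h l * K := Finset.sum_le_sum fun l hl =>
          mul_le_mul_of_nonneg_left ((greenIn_le_green hd a l).trans (haF l hl)) (hh0 l)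
      _ = (∑ l ∈ F, h l) * K := by rw [Finset.sum_mul]
      _ ≤ K := mul_le_of_le_one_left hK (sum_hitMeasIn_le_one (by omega) F a)
  · let X : Unit → Ω → ℝ := fun _ ω => φ a ω - ∑ j ∈ F, h j * φ j ω
    let Y : F → Ω → ℝ := fun j => φ j
    have hXm : Measurable (X ()) :=
      (hφ.1 a).sub (Finset.measurable_sum _ fun j _ => (hφ.1 j).const_mul _)
    have hproc : IsGaussianProcess (Sum.elim X Y) P := by
      refine hφ.isGaussianProcess.of_isGaussianProcess ?_
      rintro (_ | j)
      · refine ⟨insert a F, ContinuousLinearMap.proj ⟨a, Finset.mem_insert_self a F⟩ -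
          ∑ j : F, h j • ContinuousLinearMap.proj ⟨j, Finset.mem_insert_of_mem j.2⟩, fun ω => ?_⟩
        simp only [Sum.elim_inl, X, ← Finset.sum_coe_sort F]
        simp
      · exact ⟨{(j : Zd d)}, ContinuousLinearMap.proj ⟨j, Finset.mem_singleton_self _⟩,
          fun ω => by simp [Y]⟩
    have hind := hproc.indepFun_of_covariance_eq_zero (fun _ => hXm.aemeasurable)
      (fun j => (hφ.1 j).aemeasurable) (by
        rintro - j
        have e1 : cov[X (), Y j; P] = cov[φ a, φ j; P]
            - cov[fun ω => ∑ i ∈ F, h i * φ i ω, φ j; P] :=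
          covariance_fun_sub_left (hm a) (memLp_finsetSum F fun i _ => hhm i) (hm j)
        rw [e1, covariance_fun_sum_left' (fun i _ => hhm i) (hm j), hcov,
          greenIn_eq_sum_hitMeasIn hd hFV j.2 a, sub_eq_zero]
        refine Finset.sum_congr rfl fun i _ => ?_
        rw [covariance_const_mul_left, hcov])
    exact hind.comp (φ := fun f : Unit → ℝ => f ()) (ψ := id) (measurable_pi_apply _) measurable_id

end GaussianField

section GaussianTail

open scoped NNReal Topology

/-- The upper tail of the centered Gaussian distribution of variance `v`. -/
noncomputable def gaussTail (v : ℝ≥0) (t : ℝ) : ℝ := (gaussianReal 0 v).real (Ioi t)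

lemma gaussianReal_Ici_le {v : ℝ≥0} {K t : ℝ} (hK : 0 < K) (hv : v ≤ K) (ht : 0 ≤ t) :
    (gaussianReal 0 v).real (Ici t) ≤ exp (-t ^ 2 / (2 * K)) := by
  have hs : 0 ≤ t / K := by positivity
  have h := measure_ge_le_exp_mul_mgf (X := id) (μ := gaussianReal 0 v) t hs
    (integrable_exp_mul_gaussianReal _)
  rw [mgf_id_gaussianReal, ← exp_add] at h
  refine h.trans (exp_le_exp.2 ?_)
  have h1 : (v : ℝ) * (t / K) ^ 2 ≤ K * (t / K) ^ 2 := by gcongr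
  have h2 : -(t / K) * t + (0 * (t / K) + K * (t / K) ^ 2 / 2) = -t ^ 2 / (2 * K) := by
    field_simp; ring
  linarith

lemma gaussTail_le_exp {v : ℝ≥0} {K t : ℝ} (hK : 0 < K) (hv : v ≤ K) (ht : 0 ≤ t) :
    gaussTail v t ≤ exp (-t ^ 2 / (2 * K)) :=
  (measureReal_mono Ioi_subset_Ici_self).trans (gaussianReal_Ici_le hK hv ht)

lemma gaussianReal_abs_gt_le {v : ℝ≥0} {K t : ℝ} (hK : 0 < K) (hv : v ≤ K) (ht : 0 ≤ t) :
    (gaussianReal 0 v).real {x | t < |x|} ≤ 2 * exp (-t ^ 2 / (2 * K)) := by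
  have hsub : {x : ℝ | t < |x|} ⊆ Ioi t ∪ Iio (-t) := fun x hx => by
    rcases lt_abs.1 (show t < |x| from hx) with h | h
    · exact Or.inl h
    · exact Or.inr (show x < -t by linarith)
  have hneg : (gaussianReal 0 v).real (Iio (-t)) = gaussTail v t := by
    have h := gaussianReal_map_neg (μ := 0) (v := v)
    rw [neg_zero] at h
    rw [gaussTail, measureReal_def, measureReal_def]
    conv_rhs => rw [← h]
    rw [Measure.map_apply measurable_neg measurableSet_Ioi]
    congr 2
    ext x; simp
  have h1 := gaussTail_le_exp hK hv ht
  calc _ ≤ (gaussianReal 0 v).real (Ioi t ∪ Iio (-t)) := measureReal_mono hsub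
    _ ≤ gaussTail v t + (gaussianReal 0 v).real (Iio (-t)) := measureReal_union_le _ _
    _ ≤ _ := by rw [hneg]; linarith

lemma gaussTail_const_mul {c : ℝ} (hc : 0 < c) (v : ℝ≥0) (t : ℝ) :
    gaussTail (NNReal.mk (c ^ 2) (sq_nonneg c) * v) t = gaussTail v (t / c) := by
  have h := gaussianReal_map_const_mul (μ := 0) (v := v) c
  rw [mul_zero] at h
  rw [gaussTail, gaussTail, ← h, measureReal_def, measureReal_def,
    Measure.map_apply (measurable_const_mul c) measurableSet_Ioi]
  congr 2
  ext x
  simp only [mem_preimage, mem_Ioi, div_lt_iff₀ hc, mul_comm c x]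

lemma gaussTail_antitone (v : ℝ≥0) : Antitone (gaussTail v) := fun _ _ h =>
  measureReal_mono (Ioi_subset_Ioi h)

lemma gaussTail_nonneg (v : ℝ≥0) (t : ℝ) : 0 ≤ gaussTail v t := measureReal_nonneg

lemma gaussTail_eq {v : ℝ≥0} (hv : 0 < v) (t : ℝ) : gaussTail v t = gaussTail 1 (t / √v) := by
  have hs : 0 < √(v : ℝ) := Real.sqrt_pos.2 hv
  rw [← gaussTail_const_mul hs 1 t]
  congr 1
  ext
  simp

lemma gaussTail_mono {v v' : ℝ≥0} (h : v ≤ v') {t : ℝ} (ht : 0 ≤ t) :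
    gaussTail v t ≤ gaussTail v' t := by
  rcases eq_zero_or_pos v with rfl | hv
  · have : gaussTail 0 t = 0 := by
      rw [gaussTail, gaussianReal_zero_var, measureReal_def, Measure.dirac_apply' _ measurableSet_Ioi]
      simp [ht]
    rw [this]; exact gaussTail_nonneg _ _
  · rw [gaussTail_eq hv, gaussTail_eq (hv.trans_le h)]
    refine gaussTail_antitone 1 ?_
    have hs : 0 < √(v : ℝ) := Real.sqrt_pos.2 hv
    gcongr

lemma gaussTail_one_eq_integral (t : ℝ) :
    gaussTail 1 t = (√(2 * π))⁻¹ * ∫ x in Ioi t, exp (-x ^ 2 / 2) := by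
  rw [gaussTail, measureReal_def, gaussianReal_apply_eq_integral _ one_ne_zero,
    ENNReal.toReal_ofReal (integral_nonneg fun x => gaussianPDFReal_nonneg _ _ _),
    ← integral_const_mul]
  simp [gaussianPDFReal]

lemma hasDerivAt_neg_exp_div {x : ℝ} (hx : x ≠ 0) :
    HasDerivAt (fun x : ℝ => -(exp (-x ^ 2 / 2) / x))
      ((1 + 1 / x ^ 2) * exp (-x ^ 2 / 2)) x := by
  have h1 : HasDerivAt (fun x : ℝ => exp (-x ^ 2 / 2)) (exp (-x ^ 2 / 2) * (-(2 * x) / 2)) x := by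
    have := ((hasDerivAt_pow 2 x).neg.div_const 2).exp
    simpa using this
  convert! (h1.div (hasDerivAt_id x) hx).neg using 1
  simp only [id]
  field_simp
  ring

lemma tendsto_neg_exp_div : Tendsto (fun x : ℝ => -(exp (-x ^ 2 / 2) / x)) atTop (𝓝 0) := by
  rw [← neg_zero]
  refine Tendsto.neg ?_
  refine squeeze_zero' (g := fun x : ℝ => x⁻¹) ?_ ?_ tendsto_inv_atTop_zero
  · filter_upwards [eventually_gt_atTop 0] with x hx; positivity
  · filter_upwards [eventually_gt_atTop 0] with x hx
    rw [inv_eq_one_div]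
    gcongr
    rw [exp_le_one_iff]
    have := sq_nonneg x
    linarith

lemma integral_one_add_inv_sq_mul_exp {t : ℝ} (ht : 0 < t) :
    IntegrableOn (fun x : ℝ => (1 + 1 / x ^ 2) * exp (-x ^ 2 / 2)) (Ioi t) ∧
    ∫ x in Ioi t, (1 + 1 / x ^ 2) * exp (-x ^ 2 / 2) = exp (-t ^ 2 / 2) / t := by
  have h1 : ∀ x ∈ Ici t, HasDerivAt (fun x : ℝ => -(exp (-x ^ 2 / 2) / x))
      ((1 + 1 / x ^ 2) * exp (-x ^ 2 / 2)) x := fun x hx =>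
    hasDerivAt_neg_exp_div (ht.trans_le hx).ne'
  have h2 : ∀ x ∈ Ioi t, 0 ≤ (1 + 1 / x ^ 2) * exp (-x ^ 2 / 2) := fun x _ => by positivity
  refine ⟨integrableOn_Ioi_deriv_of_nonneg' h1 h2 tendsto_neg_exp_div, ?_⟩
  rw [integral_Ioi_of_hasDerivAt_of_nonneg' h1 h2 tendsto_neg_exp_div]
  ring

lemma integrable_exp_neg_sq_half : Integrable fun x : ℝ => exp (-x ^ 2 / 2) := by
  convert integrable_exp_neg_mul_sq (b := 1 / 2) (by norm_num) using 3
  ring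

/-- Mills ratio bounds. -/
lemma gaussTail_one_bounds {t : ℝ} (ht : 0 < t) :
    t / (1 + t ^ 2) * ((√(2 * π))⁻¹ * exp (-t ^ 2 / 2)) ≤ gaussTail 1 t ∧
    gaussTail 1 t ≤ 1 / t * ((√(2 * π))⁻¹ * exp (-t ^ 2 / 2)) := by
  obtain ⟨hi, hint⟩ := integral_one_add_inv_sq_mul_exp ht
  have hE : IntegrableOn (fun x : ℝ => exp (-x ^ 2 / 2)) (Ioi t) :=
    integrable_exp_neg_sq_half.integrableOn
  rw [gaussTail_one_eq_integral]
  have hc : 0 < (√(2 * π))⁻¹ := by positivity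
  have hup : ∫ x in Ioi t, exp (-x ^ 2 / 2) ≤ exp (-t ^ 2 / 2) / t := by
    rw [← hint]
    refine setIntegral_mono_on hE hi measurableSet_Ioi fun x _ => ?_
    exact le_mul_of_one_le_left (exp_pos _).le (le_add_of_nonneg_right (by positivity))
  have hlo : exp (-t ^ 2 / 2) / t ≤ (1 + 1 / t ^ 2) * ∫ x in Ioi t, exp (-x ^ 2 / 2) := by
    rw [← hint, ← integral_const_mul]
    refine setIntegral_mono_on hi (hE.const_mul _) measurableSet_Ioi fun x hx => ?_
    have : t < x := hx
    gcongr
  constructor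
  · have h1 : exp (-t ^ 2 / 2) / t / (1 + 1 / t ^ 2) ≤ ∫ x in Ioi t, exp (-x ^ 2 / 2) := by
      rw [div_le_iff₀ (by positivity), mul_comm]; exact hlo
    calc _ = (√(2 * π))⁻¹ * (exp (-t ^ 2 / 2) / t / (1 + 1 / t ^ 2)) := by field_simp; ring
      _ ≤ _ := by gcongr
  · calc _ ≤ (√(2 * π))⁻¹ * (exp (-t ^ 2 / 2) / t) := by gcongr
      _ = _ := by ring

end GaussianTail

section Asymptotics

open scoped NNReal Topology

/-- `b_N` as a function of `log N`. -/
noncomputable def bLog (g0 l : ℝ) : ℝ :=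
  √g0 * (√(2 * l) - (log l + log (4 * π)) / (2 * √(2 * l)))

lemma bN_eq_bLog (g0 : ℝ) (N : ℕ) : bN g0 N = bLog g0 (log N) := rfl

lemma tendsto_log_add_div_sqrt (c : ℝ) :
    Tendsto (fun l : ℝ => (log l + c) / √l) atTop (𝓝 0) := by
  have h1 : Tendsto (fun l : ℝ => log l / √l) atTop (𝓝 0) := by
    have := (isLittleO_log_rpow_atTop (r := 1 / 2) (by norm_num)).tendsto_div_nhds_zero
    simpa only [← Real.sqrt_eq_rpow] using this
  have h2 : Tendsto (fun l : ℝ => c / √l) atTop (𝓝 0) :=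
    tendsto_const_nhds.div_atTop tendsto_sqrt_atTop
  simpa [add_div] using h1.add h2

lemma tendsto_bLog_div_sqrt (g0 : ℝ) :
    Tendsto (fun l : ℝ => bLog g0 l / √l) atTop (𝓝 (√g0 * √2)) := by
  have h := (tendsto_log_add_div_sqrt (log (4 * π))).mul
    (tendsto_inv_atTop_zero.comp tendsto_sqrt_atTop)
  have h2 := ((h.const_mul (1 / (2 * √2))).const_sub √2).const_mul √g0
  simp only [mul_zero, sub_zero] at h2
  refine h2.congr' ?_
  filter_upwards [eventually_gt_atTop 0] with l hl
  have : 0 < √l := Real.sqrt_pos.2 hl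
  rw [bLog, Real.sqrt_mul zero_le_two]
  simp only [Function.comp]
  field_simp

lemma tendsto_bLog_sq {g0 : ℝ} (hg : 0 < g0) :
    Tendsto (fun l : ℝ => bLog g0 l ^ 2 / (2 * g0) - l + log l / 2) atTop
      (𝓝 (-log (4 * π) / 2)) := by
  have h := (((tendsto_log_add_div_sqrt (log (4 * π))).pow 2).const_mul (1 / 16)).const_add
    (-log (4 * π) / 2)
  simp only [ne_eq, OfNat.ofNat_ne_zero, not_false_eq_true, zero_pow, mul_zero, add_zero] at h
  refine h.congr' ?_
  filter_upwards [eventually_gt_atTop 0] with l hl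
  have h1 : √g0 ^ 2 = g0 := Real.sq_sqrt hg.le
  have h2 : √(2 * l) ^ 2 = 2 * l := Real.sq_sqrt (by positivity)
  have h3 : 0 < √(2 * l) := Real.sqrt_pos.2 (by positivity)
  have h4 : √l ^ 2 = l := Real.sq_sqrt hl.le
  have h5 : (√(2 * l) - (log l + log (4 * π)) / (2 * √(2 * l))) ^ 2 =
      2 * l - (log l + log (4 * π)) + (log l + log (4 * π)) ^ 2 / (8 * l) := by
    rw [sub_sq, div_pow, mul_pow 2 (√(2 * l)), h2]
    field_simp
    ring
  rw [bLog, mul_pow, h1, h5, div_pow, h4]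
  field_simp
  ring

/-- The level `u_N(z)` as a function of `log N`. -/
lemma uN_eq (g0 : ℝ) (N : ℕ) (z : ℝ) :
    uN g0 N z = g0 * z / bLog g0 (log N) + bLog g0 (log N) := by
  rw [uN, aN, bN_eq_bLog]; ring

lemma tendsto_bLog_atTop {g0 : ℝ} (hg : 0 < g0) : Tendsto (bLog g0) atTop atTop := by
  have h := (tendsto_bLog_div_sqrt g0).pos_mul_atTop (by positivity) tendsto_sqrt_atTop
  refine h.congr' ?_
  filter_upwards [eventually_gt_atTop 0] with l hl
  have : 0 < √l := Real.sqrt_pos.2 hl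
  field_simp

lemma tendsto_level_div_sqrt {g0 : ℝ} (hg : 0 < g0) (z : ℝ) :
    Tendsto (fun l => (g0 * z / bLog g0 l + bLog g0 l) / √l) atTop (𝓝 (√g0 * √2)) := by
  have h1 : Tendsto (fun l => g0 * z / bLog g0 l) atTop (𝓝 0) :=
    tendsto_const_nhds.div_atTop (tendsto_bLog_atTop hg)
  have h2 := (h1.div_atTop tendsto_sqrt_atTop).add (tendsto_bLog_div_sqrt g0)
  simpa [add_div] using h2

lemma tendsto_level_sq {g0 : ℝ} (hg : 0 < g0) (z : ℝ) :
    Tendsto (fun l => (g0 * z / bLog g0 l + bLog g0 l) ^ 2 / (2 * g0) - l + log l / 2) atTop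
      (𝓝 (z - log (4 * π) / 2)) := by
  have h1 : Tendsto (fun l => g0 * z / bLog g0 l) atTop (𝓝 0) :=
    tendsto_const_nhds.div_atTop (tendsto_bLog_atTop hg)
  have h2 := (((h1.pow 2).div_const (2 * g0)).add_const z).add (tendsto_bLog_sq hg)
  have e : (0 : ℝ) ^ 2 / (2 * g0) + z + -log (4 * π) / 2 = z - log (4 * π) / 2 := by ring
  rw [e] at h2
  refine h2.congr' ?_
  filter_upwards [(tendsto_bLog_atTop hg).eventually_gt_atTop 0] with l hl
  field_simp
  ring

lemma tendsto_exp_mul_gaussTail {g0 : ℝ} (hg : 0 < g0) (z : ℝ) {l : ℕ → ℝ}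
    (hl : Tendsto l atTop atTop) {v : ℕ → ℝ≥0}
    (hv : Tendsto (fun n => (g0 - v n) * l n) atTop (𝓝 0)) :
    Tendsto (fun n => exp (l n) * gaussTail (v n) (g0 * z / bLog g0 (l n) + bLog g0 (l n)))
      atTop (𝓝 (exp (-z))) := by
  set u : ℕ → ℝ := fun n => g0 * z / bLog g0 (l n) + bLog g0 (l n) 
  have hv0 : Tendsto (fun n => (v n : ℝ)) atTop (𝓝 g0) := by
    have h1 := (hv.div_atTop hl).const_sub g0
    rw [sub_zero] at h1
    refine h1.congr' ?_
    filter_upwards [hl.eventually_gt_atTop 0] with n hn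
    field_simp; ring
  have hus : Tendsto (fun n => u n / √(l n)) atTop (𝓝 (√g0 * √2)) :=
    (tendsto_level_div_sqrt hg z).comp hl
  have hsqrtl : Tendsto (fun n => √(l n)) atTop atTop := tendsto_sqrt_atTop.comp hl
  have hsl : Tendsto (fun n => u n / √(v n) / √(l n)) atTop (𝓝 √2) := by
    have h1 := hus.div (hv0.sqrt) (Real.sqrt_pos.2 hg).ne'
    rw [mul_div_cancel_left₀ _ (Real.sqrt_pos.2 hg).ne'] at h1
    exact h1.congr fun n => by simp only [Pi.div_apply]; rw [div_right_comm]
  have hs : Tendsto (fun n => u n / √(v n)) atTop atTop := by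
    refine (hsl.pos_mul_atTop (by positivity) hsqrtl).congr' ?_
    filter_upwards [hsqrtl.eventually_gt_atTop 0] with n hn
    field_simp
  have hexpo : Tendsto (fun n => u n ^ 2 / (2 * v n) - l n + log (l n) / 2) atTop
      (𝓝 (z - log (4 * π) / 2)) := by
    have h1 : Tendsto (fun n => u n ^ 2 / (2 * g0) - l n + log (l n) / 2) atTop
        (𝓝 (z - log (4 * π) / 2)) := (tendsto_level_sq hg z).comp hl
    have h2 : Tendsto (fun n => (u n / √(l n)) ^ 2 * ((g0 - v n) * l n) / (2 * v n * g0)) atTop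
        (𝓝 0) := by
      have := ((hus.pow 2).mul hv).div ((hv0.const_mul 2).mul_const g0) (by positivity)
      rw [mul_zero, zero_div] at this
      exact this
    have h3 := h1.add h2
    rw [add_zero] at h3
    refine h3.congr' ?_
    filter_upwards [hl.eventually_gt_atTop 0, hv0.eventually (lt_mem_nhds hg)] with n hn hvn
    rw [div_pow, Real.sq_sqrt hn.le]
    field_simp
    ring
  have hmain : Tendsto (fun n => exp (l n) *
      (1 / (u n / √(v n)) * ((√(2 * π))⁻¹ * exp (-(u n / √(v n)) ^ 2 / 2)))) atTop
      (𝓝 (exp (-z))) := by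
    have h1 := ((hexpo.neg.rexp).mul (hsl.inv₀ (by positivity))).mul_const (√(2 * π))⁻¹
    have e : exp (-(z - log (4 * π) / 2)) * (√2)⁻¹ * (√(2 * π))⁻¹ = exp (-z) := by
      have e1 : exp (log (4 * π) / 2) = √2 * √(2 * π) := by
        rw [← Real.sqrt_mul zero_le_two, ← Real.log_sqrt (by positivity), exp_log (by positivity)]
        ring_nf
      rw [show -(z - log (4 * π) / 2) = -z + log (4 * π) / 2 by ring, exp_add, e1]
      have : 0 < √(2 * π) := by positivity
      field_simp
    rw [e] at h1
    refine h1.congr' ?_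
    filter_upwards [hl.eventually_gt_atTop 0, hv0.eventually (lt_mem_nhds hg),
      hs.eventually_gt_atTop 0] with n hn hvn hsn
    have e2 : exp (-(u n ^ 2 / (2 * v n) - l n + log (l n) / 2)) =
        exp (l n) * exp (-(u n / √(v n)) ^ 2 / 2) * (√(l n))⁻¹ := by
      rw [← exp_log (Real.sqrt_pos.2 hn), Real.log_sqrt hn.le, ← exp_neg, ← exp_add, ← exp_add,
        div_pow, Real.sq_sqrt hvn.le]
      congr 1
      field_simp
      ring
    rw [e2]
    have : 0 < √(l n) := Real.sqrt_pos.2 hn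
    have hun : 0 < u n := by
      by_contra h
      exact absurd hsn (not_lt.2 (div_nonpos_of_nonpos_of_nonneg (not_lt.1 h) (Real.sqrt_nonneg _)))
    field_simp
  have hratio : Tendsto (fun n => 1 - 1 / (1 + (u n / √(v n)) ^ 2)) atTop (𝓝 1) := by
    have h1 : Tendsto (fun n => 1 + (u n / √(v n)) ^ 2) atTop atTop :=
      tendsto_atTop_add_const_left _ _ ((tendsto_pow_atTop two_ne_zero).comp hs)
    simpa using (tendsto_const_nhds.div_atTop h1 : Tendsto (fun n =>
      (1 : ℝ) / (1 + (u n / √(v n)) ^ 2)) atTop (𝓝 0)).const_sub 1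
  have hlow := hratio.mul hmain
  rw [one_mul] at hlow
  refine tendsto_of_tendsto_of_tendsto_of_le_of_le' hlow hmain ?_ ?_
  · filter_upwards [hv0.eventually (lt_mem_nhds hg), hs.eventually_gt_atTop 0] with n hvn hsn
    rw [gaussTail_eq (by exact_mod_cast hvn)]
    refine le_trans (le_of_eq ?_) (mul_le_mul_of_nonneg_left (gaussTail_one_bounds hsn).1
      (exp_pos _).le)
    set s := u n / √(v n)
    field_simp
    ring
  · filter_upwards [hv0.eventually (lt_mem_nhds hg), hs.eventually_gt_atTop 0] with n hvn hsn
    rw [gaussTail_eq (by exact_mod_cast hvn)]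
    exact mul_le_mul_of_nonneg_left (gaussTail_one_bounds hsn).2 (exp_pos _).le

end Asymptotics

section Intensity

open scoped NNReal Topology

lemma integrableOn_exp_neg_Ioc_coe (w : ℝ) (r : EReal) (hwr : (w : EReal) < r) :
    IntegrableOn (fun t => exp (-t)) {t : ℝ | (t : EReal) ∈ Ioc (w : EReal) r} ∧
    ∫ t in {t : ℝ | (t : EReal) ∈ Ioc (w : EReal) r}, exp (-t) = exp (-w) - expE r := by
  have hI : IntegrableOn (fun t => exp (-t)) (Ioi w) := integrableOn_exp_neg_Ioi w
  induction r using EReal.rec with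
  | bot => simp at hwr
  | top =>
    have : {t : ℝ | (t : EReal) ∈ Ioc (w : EReal) ⊤} = Ioi w := by ext t; simp
    rw [this]
    exact ⟨hI, by rw [integral_exp_neg_Ioi]; simp [expE]⟩
  | coe r =>
    have hwr' : w < r := by exact_mod_cast hwr
    have : {t : ℝ | (t : EReal) ∈ Ioc (w : EReal) r} = Ioc w r := by ext t; simp
    rw [this]
    refine ⟨hI.mono_set Ioc_subset_Ioi_self, ?_⟩
    have h := setIntegral_union (f := fun t => exp (-t)) (μ := volume)
      (Ioc_disjoint_Ioi le_rfl : Disjoint (Ioc w r) (Ioi r)) measurableSet_Ioi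
      (hI.mono_set Ioc_subset_Ioi_self) (integrableOn_exp_neg_Ioi r)
    rw [Ioc_union_Ioi_eq_Ioi hwr'.le, integral_exp_neg_Ioi, integral_exp_neg_Ioi] at h
    simp only [expE, EReal.coe_ne_top, if_false, EReal.toReal_coe]
    linarith

lemma measurableSet_coe_mem_Ioc (w : ℝ) (r : EReal) :
    MeasurableSet {t : ℝ | (t : EReal) ∈ Ioc (w : EReal) r} :=
  measurable_coe_real_ereal measurableSet_Ioc

lemma IsFiniteUnionIoc.measurableSet {R : Set EReal} (hR : IsFiniteUnionIoc R) :
    MeasurableSet R := by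
  obtain ⟨m, w, r, -, -, rfl⟩ := hR
  exact MeasurableSet.iUnion fun l => measurableSet_Ioc

lemma omegaMeas_iUnion {m : ℕ} {w : Fin m → ℝ} {r : Fin m → EReal}
    (hwr : ∀ l, (w l : EReal) < r l)
    (hdisj : Pairwise fun l l' =>
      Disjoint (Ioc (w l : EReal) (r l)) (Ioc (w l' : EReal) (r l'))) :
    omegaMeas (⋃ l, Ioc ((w l : ℝ) : EReal) (r l)) = ∑ l, (exp (-w l) - expE (r l)) := by
  have h : {t : ℝ | (t : EReal) ∈ ⋃ l, Ioc ((w l : ℝ) : EReal) (r l)} =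
      ⋃ l, {t : ℝ | (t : EReal) ∈ Ioc (w l : EReal) (r l)} := by
    ext t; simp only [mem_iUnion, mem_ofPred_eq]
  rw [omegaMeas, h, integral_iUnion_fintype]
  · exact Finset.sum_congr rfl fun l _ => (integrableOn_exp_neg_Ioc_coe _ _ (hwr l)).2
  · exact fun l => measurableSet_coe_mem_Ioc _ _
  · exact fun l l' hl => (hdisj hl).preimage _
  · exact fun l => (integrableOn_exp_neg_Ioc_coe _ _ (hwr l)).1

lemma measureReal_mem_iUnion_Ioc {Ω : Type*} [MeasurableSpace Ω] {P : Measure Ω}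
    [IsFiniteMeasure P] {Y : Ω → EReal} (hY : Measurable Y) {m : ℕ} {w : Fin m → ℝ}
    {r : Fin m → EReal} (hwr : ∀ l, (w l : EReal) < r l)
    (hdisj : Pairwise fun l l' =>
      Disjoint (Ioc (w l : EReal) (r l)) (Ioc (w l' : EReal) (r l'))) :
    P.real {x | Y x ∈ ⋃ l, Ioc ((w l : ℝ) : EReal) (r l)} =
      ∑ l, (P.real {x | (w l : EReal) < Y x} - P.real {x | r l < Y x}) := by
  have h : {x | Y x ∈ ⋃ l, Ioc ((w l : ℝ) : EReal) (r l)} =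
      ⋃ l, Y ⁻¹' Ioc (w l : EReal) (r l) := by
    ext t; simp only [mem_iUnion, mem_ofPred_eq, mem_preimage]
  rw [h, measureReal_iUnion_fintype (fun l l' hl => (hdisj hl).preimage _)
    (fun l => hY measurableSet_Ioc)]
  refine Finset.sum_congr rfl fun l _ => ?_
  have h2 : Y ⁻¹' Ioc (w l : EReal) (r l) = {x | (w l : EReal) < Y x} \ {x | r l < Y x} := by
    ext x; simp
  have h3 : {x | r l < Y x} ⊆ {x | (w l : EReal) < Y x} := fun x hx => (hwr l).trans hx
  rw [h2, measureReal_sdiff h3 (hY measurableSet_Ioi)]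

variable {g0 : ℝ} {d : ℕ} {K : ℕ → ℝ}

lemma tendsto_log_pow_atTop (hd : 0 < d) :
    Tendsto (fun n : ℕ => log ((n ^ d : ℕ) : ℝ)) atTop atTop :=
  tendsto_log_atTop.comp (tendsto_natCast_atTop_atTop.comp (tendsto_pow_atTop hd.ne'))

lemma eventually_aN_pos (hg : 0 < g0) (hd : 0 < d) : ∀ᶠ n : ℕ in atTop, 0 < aN g0 (n ^ d) := by
  filter_upwards [((tendsto_bLog_atTop hg).comp (tendsto_log_pow_atTop hd)).eventually_gt_atTop 0]
    with n hn
  exact div_pos hg hn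

lemma tendsto_uN_atTop (hg : 0 < g0) (hd : 0 < d) (z : ℝ) :
    Tendsto (fun n : ℕ => uN g0 (n ^ d) z) atTop atTop := by
  have h := (tendsto_bLog_atTop hg).comp (tendsto_log_pow_atTop hd)
  have h1 : Tendsto (fun n : ℕ => g0 * z / bLog g0 (log ((n ^ d : ℕ) : ℝ))) atTop (𝓝 0) :=
    tendsto_const_nhds.div_atTop h
  simp_rw [uN_eq]
  exact h1.add_atTop h

/-- The tail asymptotics, uniformly over variances in `[g0 - K n, g0]`. -/
lemma eventually_gaussTail_uN (hg : 0 < g0) (hd : 0 < d)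
    (hK : Tendsto (fun n : ℕ => K n * log ((n ^ d : ℕ) : ℝ)) atTop (𝓝 0)) (z : ℝ) {ε : ℝ}
    (hε : 0 < ε) : ∀ᶠ n : ℕ in atTop, ∀ v : ℝ≥0, g0 - K n ≤ v → v ≤ g0 →
      |((n ^ d : ℕ) : ℝ) * gaussTail v (uN g0 (n ^ d) z) - exp (-z)| ≤ ε := by
  have hl := tendsto_log_pow_atTop hd
  have hK0 : Tendsto K atTop (𝓝 0) := by
    refine (hK.div_atTop hl).congr' ?_
    filter_upwards [hl.eventually_gt_atTop 0] with n hn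
    field_simp
  have hlo := tendsto_exp_mul_gaussTail hg z hl (v := fun n => Real.toNNReal (g0 - K n)) (by
    refine hK.congr' ?_
    filter_upwards [hK0.eventually (gt_mem_nhds hg)] with n hn
    rw [Real.coe_toNNReal _ (by linarith)]
    ring)
  have hup := tendsto_exp_mul_gaussTail hg z hl (v := fun _ => Real.toNNReal g0) (by
    simp [Real.coe_toNNReal _ hg.le])
  filter_upwards [hlo.eventually (lt_mem_nhds (show exp (-z) - ε < _ by linarith)),
    hup.eventually (gt_mem_nhds (show _ < exp (-z) + ε by linarith)),
    (tendsto_uN_atTop hg hd z).eventually_ge_atTop 0, eventually_gt_atTop 0] with n h1 h2 h3 h4 v hv1 hv2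
  have hN : (0 : ℝ) < ((n ^ d : ℕ) : ℝ) := by positivity
  rw [exp_log hN, ← uN_eq] at h1 h2
  have e1 := mul_le_mul_of_nonneg_left
    (gaussTail_mono (Real.toNNReal_le_iff_le_coe.2 hv1) h3) hN.le
  have e2 := mul_le_mul_of_nonneg_left
    (gaussTail_mono (v := v) (v' := Real.toNNReal g0) (by
      rw [← NNReal.coe_le_coe, Real.coe_toNNReal _ hg.le]; exact hv2) h3) hN.le
  rw [abs_le]
  constructor <;> linarith

lemma gaussianReal_lt_normalized (v : ℝ≥0) {a b : ℝ} (ha : 0 < a) (z : ℝ) :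
    (gaussianReal 0 v).real {x | (z : EReal) < (((x - b) / a : ℝ) : EReal)} =
      gaussTail v (a * z + b) := by
  rw [gaussTail]
  congr 1
  ext x
  simp only [mem_ofPred_eq, EReal.coe_lt_coe_iff, lt_div_iff₀ ha, mem_Ioi, lt_sub_iff_add_lt,
    mul_comm z a]

lemma measurable_normalized (a b : ℝ) :
    Measurable fun x : ℝ => (((x - b) / a : ℝ) : EReal) :=
  measurable_coe_real_ereal.comp ((measurable_id.sub_const b).div_const a)

lemma eventually_gaussianReal_mem (hg : 0 < g0) (hd : 0 < d)
    (hK : Tendsto (fun n : ℕ => K n * log ((n ^ d : ℕ) : ℝ)) atTop (𝓝 0)) {R : Set EReal}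
    (hR : IsFiniteUnionIoc R) {ε : ℝ} (hε : 0 < ε) :
    ∀ᶠ n : ℕ in atTop, ∀ v : ℝ≥0, g0 - K n ≤ v → v ≤ g0 →
      |((n ^ d : ℕ) : ℝ) * (gaussianReal 0 v).real
        {x | (((x - bN g0 (n ^ d)) / aN g0 (n ^ d) : ℝ) : EReal) ∈ R} - omegaMeas R| ≤ ε := by
  obtain ⟨m, w, r, hwr, hdisj, rfl⟩ := hR
  have key : ∀ (e : EReal), e ≠ ⊥ → ∀ ε' > 0, ∀ᶠ n : ℕ in atTop, ∀ v : ℝ≥0, g0 - K n ≤ v → v ≤ g0 →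
      |((n ^ d : ℕ) : ℝ) * (gaussianReal 0 v).real
        {x | e < (((x - bN g0 (n ^ d)) / aN g0 (n ^ d) : ℝ) : EReal)} - expE e| ≤ ε' := by
    intro e he ε' hε'
    induction e using EReal.rec with
    | bot => simp at he
    | top => exact Eventually.of_forall fun n v _ _ => by simp [expE, hε'.le]
    | coe z =>
      filter_upwards [eventually_gaussTail_uN hg hd hK z hε', eventually_aN_pos hg hd]
        with n h1 h2 v hv1 hv2
      rw [gaussianReal_lt_normalized v h2]
      simpa [expE, uN] using h1 v hv1 hv2
  have hε' : 0 < ε / (2 * (m + 1)) := by positivity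
  have h1 := eventually_all.2 fun l => key (w l) (EReal.coe_ne_bot _) _ hε'
  have h2 := eventually_all.2 fun l => key (r l) (bot_le.trans_lt (hwr l)).ne' _ hε'
  filter_upwards [h1, h2] with n h1 h2 v hv1 hv2
  rw [omegaMeas_iUnion hwr hdisj, measureReal_mem_iUnion_Ioc (measurable_normalized _ _) hwr hdisj,
    Finset.mul_sum, ← Finset.sum_sub_distrib]
  calc _ ≤ ∑ l : Fin m, (ε / (2 * (m + 1)) + ε / (2 * (m + 1))) := by
        refine (Finset.abs_sum_le_sum_abs _ _).trans (Finset.sum_le_sum fun l _ => ?_)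
        have e1 := h1 l v hv1 hv2
        have e2 := h2 l v hv1 hv2
        simp only [expE, EReal.coe_ne_top, if_false, EReal.toReal_coe] at e1
        rw [mul_sub, sub_sub_sub_comm]
        exact (abs_sub _ _).trans (add_le_add e1 e2)
    _ = m * (ε / (m + 1)) := by
        rw [Finset.sum_const, Finset.card_univ, Fintype.card_fin, nsmul_eq_mul]; field_simp; ring
    _ ≤ ε := by
        rw [← mul_div_assoc, div_le_iff₀ (by positivity)]; nlinarith

lemma exists_eventually_gaussianReal_near (hg : 0 < g0) (hd : 0 < d)
    (hK : Tendsto (fun n : ℕ => K n * log ((n ^ d : ℕ) : ℝ)) atTop (𝓝 0)) (e : ℝ) {ε : ℝ}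
    (hε : 0 < ε) : ∃ η₀ > 0, ∀ η, 0 < η → η ≤ η₀ →
    ∀ᶠ n : ℕ in atTop, ∀ v : ℝ≥0, g0 - K n ≤ v → v ≤ g0 →
      ((n ^ d : ℕ) : ℝ) * (gaussianReal 0 v).real
        {x | |(x - bN g0 (n ^ d)) / aN g0 (n ^ d) - e| ≤ η} ≤ ε := by
  have hcont : Tendsto (fun η : ℝ => exp (-(e - 2 * η)) - exp (-(e + η))) (𝓝 0) (𝓝 0) := by
    have : Continuous fun η : ℝ => exp (-(e - 2 * η)) - exp (-(e + η)) := by fun_prop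
    simpa using this.tendsto 0
  obtain ⟨η₁, hη₁, h⟩ := Metric.eventually_nhds_iff.1
    (hcont.eventually (gt_mem_nhds (show (0 : ℝ) < ε / 3 by positivity)))
  refine ⟨η₁ / 2, by positivity, fun η hη0 hη => ?_⟩
  have hη' := h (y := η) (by rw [dist_zero_right, norm_eq_abs, abs_of_pos hη0]; linarith)
  filter_upwards [eventually_gaussTail_uN hg hd hK (e - 2 * η) (show 0 < ε / 3 by positivity),
    eventually_gaussTail_uN hg hd hK (e + η) (show 0 < ε / 3 by positivity),
    eventually_aN_pos hg hd] with n h1 h2 h3 v hv1 hv2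
  have e1 := (abs_le.1 (h1 v hv1 hv2)).2
  have e2 := (abs_le.1 (h2 v hv1 hv2)).1
  have hsub : {x | |(x - bN g0 (n ^ d)) / aN g0 (n ^ d) - e| ≤ η} ⊆
      Ioi (uN g0 (n ^ d) (e - 2 * η)) \ Ioi (uN g0 (n ^ d) (e + η)) := by
    intro x hx
    rw [mem_ofPred_eq, abs_le] at hx
    have hx1 : e - η ≤ (x - bN g0 (n ^ d)) / aN g0 (n ^ d) := by linarith
    have hx2 : (x - bN g0 (n ^ d)) / aN g0 (n ^ d) ≤ e + η := by linarith
    rw [le_div_iff₀ h3] at hx1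
    rw [div_le_iff₀ h3] at hx2
    simp only [Set.mem_sdiff, mem_Ioi, uN, not_lt]
    constructor <;> nlinarith
  have hle : (gaussianReal 0 v).real {x | |(x - bN g0 (n ^ d)) / aN g0 (n ^ d) - e| ≤ η} ≤
      gaussTail v (uN g0 (n ^ d) (e - 2 * η)) - gaussTail v (uN g0 (n ^ d) (e + η)) := by
    refine (measureReal_mono hsub).trans_eq ?_
    refine measureReal_sdiff (Ioi_subset_Ioi ?_) measurableSet_Ioi
    simp only [uN]
    nlinarith
  have hN : (0 : ℝ) ≤ ((n ^ d : ℕ) : ℝ) := by positivity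
  have := mul_le_mul_of_nonneg_left hle hN
  rw [mul_sub] at this
  linarith

end Intensity

section BulkVariance

open scoped NNReal Topology

lemma distInf_comm (d : ℕ) (a b : Zd d) : distInf d a b = distInf d b a := by
  have h : ∀ i, (a i - b i).natAbs = (b i - a i).natAbs := fun i => by
    rw [← Int.natAbs_neg, neg_sub]
  simp only [distInf, h]

lemma mem_bulk {d n : ℕ} {δ : ℝ} {a : Zd d} :
    a ∈ bulk d n δ ↔ a ∈ VN d n ∧ ∀ b : Zd d, b ∉ VN d n → δ * n < distInf d a b := by
  classical
  exact Finset.mem_filter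

/-- The diagonal of the Dirichlet Green's function is close to `g(0)` in the bulk. -/
lemma exists_greenIn_bulk_bounds {d : ℕ} (hd : 3 ≤ d) {δ : ℝ} (hδ : 0 < δ) :
    ∃ K : ℕ → ℝ, Tendsto (fun n : ℕ => K n * log ((n ^ d : ℕ) : ℝ)) atTop (𝓝 0) ∧
      ∀ᶠ n in atTop, ∀ a ∈ bulk d n δ, green d 0 0 - K n ≤ greenIn d (VN d n) a a ∧
        greenIn d (VN d n) a a ≤ green d 0 0 := by
  obtain ⟨C, hC, hdec⟩ := green_decay hd
  refine ⟨fun n => C * (δ * n) ^ (-(1 / 4) : ℝ), ?_, ?_⟩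
  · have h1 := ((isLittleO_log_rpow_atTop (r := 1 / 4) (by norm_num)).tendsto_div_nhds_zero).comp
      tendsto_natCast_atTop_atTop
    have h2 := h1.const_mul (C * δ ^ (-(1 / 4) : ℝ) * d)
    rw [mul_zero] at h2
    refine h2.congr fun n => ?_
    simp only [Function.comp, Nat.cast_pow, Real.log_pow]
    rw [Real.mul_rpow hδ.le n.cast_nonneg, Real.rpow_neg n.cast_nonneg]
    ring
  · filter_upwards [eventually_gt_atTop 0] with n hn a ha
    have hr : 0 < δ * n := by positivity
    have h0 := green_self hd a
    refine ⟨?_, h0 ▸ greenIn_le_green hd a a⟩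
    have := green_le_greenIn_add (Λ := (VN d n : Set (Zd d))) (b := a)
      (K := C * (δ * n) ^ (-(1 / 4) : ℝ)) hd (fun c hc => by
        refine hdec c a _ hr ?_
        rw [distInf_comm]
        exact ((mem_bulk.1 ha).2 c hc).le) (by positivity) a
    linarith

end BulkVariance

section Mixing

open scoped NNReal Topology

variable {Ω : Type*} [MeasurableSpace Ω] {P : Measure Ω}

/-- If `Y` differs little from a variable independent of `W`, then `{Y ∈ D}` is almost independent
of events in `σ(W)`. -/
lemma abs_measureReal_inter_sub_mul_le [IsProbabilityMeasure P] {α : Type*} [MeasurableSpace α]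
    {Y L : Ω → ℝ} {W : Ω → α} (hind : IndepFun (fun ω => Y ω - L ω) W P) {D : Set ℝ}
    (hD : MeasurableSet D) {B : Set α} (hB : MeasurableSet B) (E : Finset ℝ) {η : ℝ}
    (hE : ∀ y y', |y - y'| ≤ η → ¬ (y ∈ D ↔ y' ∈ D) → ∃ e ∈ E, |y - e| ≤ η) :
    |P.real ((Y ⁻¹' D) ∩ (W ⁻¹' B)) - P.real (Y ⁻¹' D) * P.real (W ⁻¹' B)| ≤
      2 * (P.real {ω | η < |L ω|} + ∑ e ∈ E, P.real {ω | |Y ω - e| ≤ η}) := by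
  set Z : Ω → ℝ := fun ω => Y ω - L ω
  set T := {ω | η < |L ω|} ∪ ⋃ e ∈ E, {ω | |Y ω - e| ≤ η}
  have hT : P.real T ≤ P.real {ω | η < |L ω|} + ∑ e ∈ E, P.real {ω | |Y ω - e| ≤ η} :=
    (measureReal_union_le _ _).trans (by gcongr; exact measureReal_biUnion_finset_le _ _)
  have hiff : ∀ ω ∉ T, (Y ω ∈ D ↔ Z ω ∈ D) := by
    intro ω hω
    by_contra h
    simp only [T, mem_union, mem_ofPred_eq, mem_iUnion, not_or, not_lt, not_exists] at hω
    obtain ⟨e, he, h'⟩ := hE (Y ω) (Z ω) (by simpa [Z] using hω.1) h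
    exact hω.2 e he h'
  have hcmp : ∀ U U' : Set Ω, (∀ ω ∉ T, ω ∈ U → ω ∈ U') → P.real U ≤ P.real U' + P.real T := by
    intro U U' h
    refine (measureReal_mono (μ := P) (fun ω hω => ?_) : P.real U ≤ P.real (U' ∪ T)).trans
      (measureReal_union_le _ _)
    by_cases hT : ω ∈ T
    · exact Or.inr hT
    · exact Or.inl (h ω hT hω)
  have h1 := hcmp (Y ⁻¹' D) (Z ⁻¹' D) fun ω hω h => (hiff ω hω).1 h
  have h2 := hcmp (Z ⁻¹' D) (Y ⁻¹' D) fun ω hω h => (hiff ω hω).2 h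
  have h3 := hcmp (Y ⁻¹' D ∩ W ⁻¹' B) (Z ⁻¹' D ∩ W ⁻¹' B) fun ω hω h => ⟨(hiff ω hω).1 h.1, h.2⟩
  have h4 := hcmp (Z ⁻¹' D ∩ W ⁻¹' B) (Y ⁻¹' D ∩ W ⁻¹' B) fun ω hω h => ⟨(hiff ω hω).2 h.1, h.2⟩
  have h5 : P.real (Z ⁻¹' D ∩ W ⁻¹' B) = P.real (Z ⁻¹' D) * P.real (W ⁻¹' B) := by
    rw [measureReal_def, hind.measure_inter_preimage_eq_mul _ _ hD hB, ENNReal.toReal_mul]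
    rfl
  have hB0 : 0 ≤ P.real (W ⁻¹' B) := measureReal_nonneg
  have hB1 : P.real (W ⁻¹' B) ≤ 1 := measureReal_le_one
  have hT0 : 0 ≤ P.real T := measureReal_nonneg
  rw [abs_le]
  constructor <;> nlinarith

lemma IsFiniteUnionIoc.exists_endpoints {R : Set EReal} (hR : IsFiniteUnionIoc R) :
    ∃ E : Finset ℝ, ∀ y y' η : ℝ, |y - y'| ≤ η → ¬ ((y : EReal) ∈ R ↔ (y' : EReal) ∈ R) →
      ∃ e ∈ E, |y - e| ≤ η := by
  classical
  obtain ⟨m, w, r, hwr, -, rfl⟩ := hR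
  refine ⟨Finset.univ.image w ∪ Finset.univ.image fun l => (r l).toReal, ?_⟩
  have hw : ∀ l, w l ∈ Finset.univ.image w ∪ Finset.univ.image fun l => (r l).toReal :=
    fun l => Finset.mem_union_left _ (Finset.mem_image_of_mem _ (Finset.mem_univ _))
  have hr : ∀ l, (r l).toReal ∈ Finset.univ.image w ∪ Finset.univ.image fun l => (r l).toReal :=
    fun l => Finset.mem_union_right _
      (Finset.mem_image_of_mem (fun l => (r l).toReal) (Finset.mem_univ _))
  have key : ∀ x x' : ℝ, (x : EReal) ∈ ⋃ l, Ioc ((w l : ℝ) : EReal) (r l) →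
      (x' : EReal) ∉ ⋃ l, Ioc ((w l : ℝ) : EReal) (r l) →
      ∃ e ∈ Finset.univ.image w ∪ Finset.univ.image fun l => (r l).toReal,
        (x' ≤ e ∧ e ≤ x) ∨ (x ≤ e ∧ e ≤ x') := by
    intro x x' hx hx'
    obtain ⟨l, hl⟩ := mem_iUnion.1 hx
    rw [mem_iUnion, not_exists] at hx'
    by_cases h : x' ≤ w l
    · exact ⟨w l, hw l, Or.inl ⟨h, (EReal.coe_lt_coe_iff.1 hl.1).le⟩⟩
    · have h' : ¬ (x' : EReal) ≤ r l := fun h'' =>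
        hx' l ⟨EReal.coe_lt_coe_iff.2 (not_le.1 h), h''⟩
      have htop : r l ≠ ⊤ := fun e => h' (e ▸ le_top)
      have hbot : r l ≠ ⊥ := (bot_le.trans_lt (hwr l)).ne'
      have hcoe := EReal.coe_toReal htop hbot
      rw [← hcoe] at h' hl
      exact ⟨_, hr l, Or.inr ⟨EReal.coe_le_coe_iff.1 hl.2,
        (EReal.coe_lt_coe_iff.1 (not_le.1 h')).le⟩⟩
  intro y y' η hη hne
  rw [abs_le] at hη
  by_cases hy : (y : EReal) ∈ ⋃ l, Ioc ((w l : ℝ) : EReal) (r l)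
  · obtain ⟨e, he, h⟩ := key y y' hy fun h' => hne ⟨fun _ => h', fun _ => hy⟩
    refine ⟨e, he, abs_le.2 ?_⟩
    rcases h with h | h <;> constructor <;> linarith [h.1, h.2]
  · have hy' : (y' : EReal) ∈ ⋃ l, Ioc ((w l : ℝ) : EReal) (r l) := by
      by_contra h'
      exact hne ⟨fun h => absurd h hy, fun h => absurd h h'⟩
    obtain ⟨e, he, h⟩ := key y' y hy' hy
    refine ⟨e, he, abs_le.2 ?_⟩
    rcases h with h | h <;> constructor <;> linarith [h.1, h.2]

lemma tendsto_exp_mul_exp_neg {g0 : ℝ} (hg : 0 < g0) {c : ℝ} (hc : 0 < c) :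
    Tendsto (fun l : ℝ => exp l * exp (-(c * (g0 / bLog g0 l) ^ 2 * l ^ 4))) atTop (𝓝 0) := by
  have h1 : Tendsto (fun l : ℝ => (g0 / (bLog g0 l / √l)) ^ 2) atTop (𝓝 ((g0 / (√g0 * √2)) ^ 2)) :=
    (tendsto_const_nhds.div (tendsto_bLog_div_sqrt g0) (by positivity)).pow 2
  have h2 : Tendsto (fun l : ℝ => c * (g0 / (bLog g0 l / √l)) ^ 2 * l ^ 2) atTop atTop :=
    (h1.const_mul c).pos_mul_atTop (by positivity) (tendsto_pow_atTop two_ne_zero)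
  have h3 : Tendsto (fun l : ℝ => l * (1 - c * (g0 / (bLog g0 l / √l)) ^ 2 * l ^ 2)) atTop atBot :=
    tendsto_id.atTop_mul_atBot₀
      (tendsto_atBot_add_const_left _ 1 (tendsto_neg_atTop_atBot.comp h2))
  refine (tendsto_exp_atBot.comp h3).congr' ?_
  filter_upwards [eventually_gt_atTop 0] with l hl
  have h4 : √l ^ 2 = l := Real.sq_sqrt hl.le
  have h5 : (g0 / (bLog g0 l / √l)) ^ 2 = (g0 / bLog g0 l) ^ 2 * l := by
    rw [div_div_eq_mul_div, mul_div_right_comm, mul_pow, h4]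
  rw [Function.comp_apply, ← exp_add, h5]
  ring_nf

end Mixing

section GaussianFieldInBox

open scoped NNReal Topology

variable {Ω : Type*} [MeasurableSpace Ω] {P : Measure Ω} {d : ℕ} {δ : ℝ}
  {ψ : (n : ℕ) → Zd d → Ω → ℝ}

lemma IsGaussianField.measureReal_mem_eq {φ : Zd d → Ω → ℝ} {G : Zd d → Zd d → ℝ}
    (hφ : IsGaussianField P d G φ) (a : Zd d) {D : Set ℝ} (hD : MeasurableSet D) :
    P.real {ω | φ a ω ∈ D} = (gaussianReal 0 (G a a).toNNReal).real D := by
  rw [← hφ.map_eval a, measureReal_def, measureReal_def, Measure.map_apply (hφ.1 a) hD]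
  rfl

lemma exp_log_natCast_pow {n : ℕ} (hn : 0 < n) (d : ℕ) :
    exp (log ((n ^ d : ℕ) : ℝ)) = ((n ^ d : ℕ) : ℝ) :=
  exp_log (by positivity)

lemma measurableSet_normalized {R : Set EReal} (hR : IsFiniteUnionIoc R) (a b : ℝ) :
    MeasurableSet {x : ℝ | (((x - b) / a : ℝ) : EReal) ∈ R} :=
  measurable_normalized a b hR.measurableSet

/-- One-point intensities in the bulk converge uniformly. -/
lemma eventually_bulk_intensity (hd : 3 ≤ d) (hδ : 0 < δ)
    (hψ : ∀ n, IsGaussianField P d (greenIn d (VN d n : Set (Zd d))) (ψ n))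
    {R : Set EReal} (hR : IsFiniteUnionIoc R) {ε : ℝ} (hε : 0 < ε) :
    ∀ᶠ n : ℕ in atTop, ∀ a ∈ bulk d n δ, |((n ^ d : ℕ) : ℝ) * P.real {ω |
      (((ψ n a ω - bN (green d 0 0) (n ^ d)) / aN (green d 0 0) (n ^ d) : ℝ) : EReal) ∈ R} -
        omegaMeas R| ≤ ε := by
  have hg : 0 < green d 0 0 := lt_of_lt_of_le (by norm_num) (half_le_green_zero hd)
  obtain ⟨K, hK, hKb⟩ := exists_greenIn_bulk_bounds hd hδ
  filter_upwards [hKb, eventually_gaussianReal_mem hg (by omega) hK hR hε] with n h1 h2 a ha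
  have h3 := (h1 a ha)
  have h4 := h2 (greenIn d (VN d n) a a).toNNReal
  rw [Real.coe_toNNReal _ (greenIn_nonneg a a)] at h4
  have h5 := (hψ n).measureReal_mem_eq a (measurableSet_normalized hR (aN (green d 0 0) (n ^ d))
    (bN (green d 0 0) (n ^ d)))
  simp only [mem_ofPred_eq] at h5
  rw [h5]
  exact h4 h3.1 h3.2

/-- A bulk point is asymptotically independent of everything at distance more than a power of
`log N`. -/
lemma eventually_abs_inter_far_le [IsProbabilityMeasure P] (hd : 3 ≤ d) (hδ : 0 < δ)
    (hψ : ∀ n, IsGaussianField P d (greenIn d (VN d n : Set (Zd d))) (ψ n))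
    {R : Set EReal} (hR : IsFiniteUnionIoc R) {ε : ℝ} (hε : 0 < ε) (ι : Type*) :
    ∀ᶠ n : ℕ in atTop, ∀ a ∈ bulk d n δ, ∀ (I : Finset ι) (p : ι → Zd d) (D : ι → Set ℝ),
      (∀ i, MeasurableSet (D i)) →
      (∀ i ∈ I, p i ∈ VN d n ∧ log ((n ^ d : ℕ) : ℝ) ^ 16 < distInf d a (p i)) →
      |P.real ({ω | (((ψ n a ω - bN (green d 0 0) (n ^ d)) / aN (green d 0 0) (n ^ d) : ℝ) :
          EReal) ∈ R} ∩ ⋂ i ∈ I, {ω | ψ n (p i) ω ∈ D i}) -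
        P.real {ω | (((ψ n a ω - bN (green d 0 0) (n ^ d)) / aN (green d 0 0) (n ^ d) : ℝ) :
          EReal) ∈ R} * P.real (⋂ i ∈ I, {ω | ψ n (p i) ω ∈ D i})| ≤ ε / ((n ^ d : ℕ) : ℝ) := by
  classical
  have hd0 : 0 < d := by omega
  set g0 := green d 0 0 with hg0
  have hg : 0 < g0 := lt_of_lt_of_le (by norm_num) (half_le_green_zero hd)
  obtain ⟨K, hK, hKb⟩ := exists_greenIn_bulk_bounds hd hδ
  obtain ⟨C, hC, hdec⟩ := green_decay hd
  obtain ⟨E, hE⟩ := hR.exists_endpoints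
  set ε' := ε / (4 * (E.card + 1)) with hε'
  have hε'0 : 0 < ε' := by positivity
  choose η₀ hη₀ hnear using fun e : ℝ => exists_eventually_gaussianReal_near hg hd0 hK e hε'0
  obtain ⟨η, hη, hηE⟩ : ∃ η : ℝ, 0 < η ∧ ∀ e ∈ E, η ≤ η₀ e := by
    have h : ∀ᶠ η in 𝓝[>] (0 : ℝ), 0 < η ∧ ∀ e ∈ E, η ≤ η₀ e := by
      refine (eventually_mem_nhdsWithin).and ((Finset.eventually_all E).2 fun e _ => ?_)
      filter_upwards [Ioc_mem_nhdsGT (hη₀ e)] with η h using h.2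
    exact h.exists
  have hnearE : ∀ᶠ n : ℕ in atTop, ∀ e ∈ E, ∀ v : ℝ≥0, g0 - K n ≤ v → v ≤ g0 →
      ((n ^ d : ℕ) : ℝ) * (gaussianReal 0 v).real
        {x | |(x - bN g0 (n ^ d)) / aN g0 (n ^ d) - e| ≤ η} ≤ ε' :=
    (Finset.eventually_all E).2 fun e he => hnear e η hη (hηE e he)
  have hl := tendsto_log_pow_atTop hd0
  have hexp := ((tendsto_exp_mul_exp_neg hg (c := η ^ 2 / (2 * C)) (by positivity)).comp
    hl).eventually (gt_mem_nhds (show 0 < ε / 8 by positivity))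
  filter_upwards [hKb, hnearE, hexp, hl.eventually_gt_atTop 0, eventually_aN_pos hg hd0,
    eventually_gt_atTop 0] with n hKn hEn hexpn hln haN hn a ha I p D hD hI
  have hN : (0 : ℝ) < ((n ^ d : ℕ) : ℝ) := by positivity
  set l := log ((n ^ d : ℕ) : ℝ)
  have hdist : ∀ j ∈ I.image p, green d a j ≤ C / l ^ 4 := by
    intro j hj
    obtain ⟨i, hi, rfl⟩ := Finset.mem_image.1 hj
    refine (hdec a (p i) (l ^ 16) (by positivity) (hI i hi).2.le).trans_eq ?_
    rw [Real.rpow_neg (by positivity), ← Real.rpow_natCast, ← Real.rpow_natCast,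
      ← Real.rpow_mul hln.le]
    norm_num [div_eq_mul_inv]
  obtain ⟨L, v, hLm, hLmap, hv, hind⟩ := IsGaussianField.exists_decomposition hd
    (F := I.image p) (fun j hj => by
      obtain ⟨i, hi, rfl⟩ := Finset.mem_image.1 hj
      exact (hI i hi).1) (hψ n) a (show 0 ≤ C / l ^ 4 by positivity) hdist
  set A := aN g0 (n ^ d)
  set b := bN g0 (n ^ d) with hb
  have hind' : IndepFun (fun ω => (ψ n a ω - b) / A - L ω / A)
      (fun ω (j : I.image p) => ψ n j ω) P := by
    have h : (fun ω => (ψ n a ω - b) / A - L ω / A) =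
        (fun x => (x - b) / A) ∘ fun ω => ψ n a ω - L ω := by
      ext ω
      simp only [Function.comp]
      ring
    rw [h]
    exact hind.comp ((measurable_id.sub_const b).div_const A) measurable_id
  have hB : MeasurableSet {w : I.image p → ℝ | ∀ i, ∀ hi : i ∈ I,
      w ⟨p i, Finset.mem_image_of_mem p hi⟩ ∈ D i} := by
    have : {w : I.image p → ℝ | ∀ i, ∀ hi : i ∈ I, w ⟨p i, Finset.mem_image_of_mem p hi⟩ ∈ D i} =
        ⋂ i : I, (fun w : I.image p → ℝ => w ⟨p i, Finset.mem_image_of_mem p i.2⟩) ⁻¹' D i := by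
      ext w; simp
    rw [this]
    exact MeasurableSet.iInter fun i => measurable_pi_apply _ (hD i)
  have hmix := abs_measureReal_inter_sub_mul_le hind'
    (D := {y : ℝ | (y : EReal) ∈ R}) (measurable_coe_real_ereal hR.measurableSet) hB E
    (η := η) (fun y y' => hE y y' η)
  have hW : (fun ω (j : I.image p) => ψ n j ω) ⁻¹' {w : I.image p → ℝ | ∀ i, ∀ hi : i ∈ I,
      w ⟨p i, Finset.mem_image_of_mem p hi⟩ ∈ D i} = ⋂ i ∈ I, {ω | ψ n (p i) ω ∈ D i} := by
    ext ω; simp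
  rw [hW] at hmix
  refine hmix.trans ?_
  have hL : P.real {ω | η < |L ω / A|} ≤ 2 * exp (-(η ^ 2 / (2 * C) * A ^ 2 * l ^ 4)) := by
    have h1 : P.real {ω | η < |L ω / A|} = (gaussianReal 0 v).real {x | η * A < |x|} := by
      rw [← hLmap, measureReal_def, measureReal_def, Measure.map_apply hLm
        (measurableSet_lt measurable_const (by fun_prop : Measurable fun x : ℝ => |x|))]
      congr 2
      ext ω
      simp only [mem_ofPred_eq, mem_preimage, abs_div, abs_of_pos haN, lt_div_iff₀ haN]
    rw [h1]
    refine (gaussianReal_abs_gt_le (show 0 < C / l ^ 4 by positivity) hv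
      (by positivity)).trans_eq ?_
    congr 2
    field_simp
  have hLN : ((n ^ d : ℕ) : ℝ) * P.real {ω | η < |L ω / A|} ≤ ε / 4 := by
    have h1 : ((n ^ d : ℕ) : ℝ) * exp (-(η ^ 2 / (2 * C) * A ^ 2 * l ^ 4)) < ε / 8 := by
      rw [← exp_log_natCast_pow hn d]
      exact hexpn
    nlinarith [mul_le_mul_of_nonneg_left hL hN.le]
  have hEN : ∀ e ∈ E, ((n ^ d : ℕ) : ℝ) * P.real {ω | |(ψ n a ω - b) / A - e| ≤ η} ≤ ε' := by
    intro e he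
    have h3 := hKn a ha
    have h4 := hEn e he (greenIn d (VN d n) a a).toNNReal
    rw [Real.coe_toNNReal _ (greenIn_nonneg a a)] at h4
    have h5 := (hψ n).measureReal_mem_eq a (D := {x | |(x - b) / A - e| ≤ η})
      (measurableSet_le (by fun_prop) measurable_const)
    simp only [mem_ofPred_eq] at h5
    rw [h5]
    exact h4 h3.1 h3.2
  have hsum : ((n ^ d : ℕ) : ℝ) * ∑ e ∈ E, P.real {ω | |(ψ n a ω - b) / A - e| ≤ η} ≤ ε / 4 := by
    rw [Finset.mul_sum]
    refine (Finset.sum_le_card_nsmul _ _ _ hEN).trans ?_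
    rw [nsmul_eq_mul, hε']
    have : (E.card : ℝ) * (ε / (4 * (E.card + 1))) = ε / 4 * (E.card / (E.card + 1)) := by
      field_simp
    rw [this]
    have h : (E.card : ℝ) / (E.card + 1) ≤ 1 := by
      rw [div_le_one (by positivity)]; linarith
    nlinarith
  rw [le_div_iff₀ hN]
  linarith

end GaussianFieldInBox

section PairBounds

open scoped NNReal Topology

variable {Ω : Type*} [MeasurableSpace Ω] {P : Measure Ω} {d : ℕ} {ψ : (n : ℕ) → Zd d → Ω → ℝ}

lemma IsFiniteUnionIoc.exists_lt {R : Set EReal} (hR : IsFiniteUnionIoc R) :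
    ∃ w : ℝ, ∀ x ∈ R, (w : EReal) < x := by
  obtain ⟨m, w, r, -, -, rfl⟩ := hR
  obtain ⟨w₀, hw₀⟩ := (Set.finite_range w).bddBelow
  refine ⟨w₀, fun x hx => ?_⟩
  obtain ⟨l, hl⟩ := mem_iUnion.1 hx
  exact (EReal.coe_le_coe_iff.2 (hw₀ (mem_range_self l))).trans_lt hl.1

/-- Two distinct sites are simultaneously high with probability at most `N ^ (-(1 + κ))`. -/
lemma exists_eventually_pair_le [IsProbabilityMeasure P] (hd : 3 ≤ d)
    (hψ : ∀ n, IsGaussianField P d (greenIn d (VN d n : Set (Zd d))) (ψ n)) (w : ℝ) :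
    ∃ κ > 0, ∀ᶠ n : ℕ in atTop, ∀ a b, a ≠ b →
      P.real {ω | uN (green d 0 0) (n ^ d) w < ψ n a ω ∧ uN (green d 0 0) (n ^ d) w < ψ n b ω} ≤
        exp (-((1 + κ) * log ((n ^ d : ℕ) : ℝ))) := by
  have hd0 : 0 < d := by omega
  set g0 := green d 0 0
  have hg2 : 1 / 2 ≤ g0 := half_le_green_zero hd
  have hg : 0 < g0 := by linarith
  have hV : 0 < 4 * g0 - 1 := by linarith
  set κ := 1 / (2 * (4 * g0 - 1)) with hκ
  have hκ0 : 0 < κ := by positivity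
  refine ⟨κ, hκ0, ?_⟩
  have hl := tendsto_log_pow_atTop hd0
  have hlim := (((tendsto_level_div_sqrt hg w).comp hl).pow 2).const_mul (2 / (4 * g0 - 1))
  have hlt : 1 + κ < 2 / (4 * g0 - 1) * (√g0 * √2) ^ 2 := by
    rw [mul_pow, Real.sq_sqrt hg.le, Real.sq_sqrt two_pos.le, hκ]
    rw [← sub_pos]
    have : 2 / (4 * g0 - 1) * (g0 * 2) - (1 + 1 / (2 * (4 * g0 - 1))) = 1 / (2 * (4 * g0 - 1)) := by
      field_simp
      ring
    rw [this]
    positivity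
  filter_upwards [hlim.eventually (lt_mem_nhds hlt), hl.eventually_gt_atTop 0,
    (tendsto_uN_atTop hg hd0 w).eventually_gt_atTop 0] with n h1 hln hu a b hab
  set l := log ((n ^ d : ℕ) : ℝ)
  set u := uN g0 (n ^ d) w with hu_def
  have hsub : P.real {ω | u < ψ n a ω ∧ u < ψ n b ω} ≤
      P.real ((fun ω => ψ n a ω + ψ n b ω) ⁻¹' Ioi (2 * u)) :=
    measureReal_mono fun ω hω => by
      have h1 : u < ψ n a ω := hω.1
      have h2 : u < ψ n b ω := hω.2
      simp only [mem_preimage, mem_Ioi]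
      linarith
  refine hsub.trans ?_
  have hm : Measurable fun ω => ψ n a ω + ψ n b ω := ((hψ n).1 a).add ((hψ n).1 b)
  rw [measureReal_def, ← Measure.map_apply hm measurableSet_Ioi,
    (hψ n).map_add hab]
  have hvar : greenIn d (VN d n : Set (Zd d)) a a + greenIn d (VN d n : Set (Zd d)) a b +
      (greenIn d (VN d n : Set (Zd d)) b a + greenIn d (VN d n : Set (Zd d)) b b) ≤
        4 * g0 - 1 := by
    have e1 := greenIn_le_green (Λ := (VN d n : Set (Zd d))) hd a a
    have e2 := greenIn_le_green (Λ := (VN d n : Set (Zd d))) hd a b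
    have e3 := greenIn_le_green (Λ := (VN d n : Set (Zd d))) hd b a
    have e4 := greenIn_le_green (Λ := (VN d n : Set (Zd d))) hd b b
    have f1 : green d a a = g0 := green_self hd a
    have f2 : green d b b = g0 := green_self hd b
    have f3 : green d a b ≤ g0 - 1 / 2 := green_le_sub_half hd hab
    have f4 : green d b a ≤ g0 - 1 / 2 := green_le_sub_half hd hab.symm
    linarith
  refine (gaussTail_le_exp hV (by rw [Real.coe_toNNReal']; exact max_le hvar hV.le) (by positivity)).trans ?_
  rw [exp_le_exp, neg_div, neg_le_neg_iff]
  simp only [Function.comp, ← uN_eq, ← hu_def] at h1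
  calc (1 + κ) * l ≤ 2 / (4 * g0 - 1) * (u / √l) ^ 2 * l := by gcongr
    _ = (2 * u) ^ 2 / (2 * (4 * g0 - 1)) := by
      rw [div_pow, Real.sq_sqrt hln.le]
      field_simp

end PairBounds

section Counting

lemma card_VN (d n : ℕ) : (VN d n).card = n ^ d := by
  simp [VN]

lemma bulk_subset_VN (d n : ℕ) (δ : ℝ) : bulk d n δ ⊆ VN d n := fun _ h => (mem_bulk.1 h).1

lemma card_distInf_le (d : ℕ) (S : Finset (Zd d)) (a : Zd d) {s : ℝ} (hs : 0 ≤ s)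
    [DecidablePred fun b => distInf d a b ≤ s] :
    ((S.filter fun b => distInf d a b ≤ s).card : ℝ) ≤ (2 * s + 1) ^ d := by
  have hsub : S.filter (fun b => distInf d a b ≤ s) ⊆
      Fintype.piFinset fun i => Finset.Icc (a i - ⌊s⌋₊) (a i + ⌊s⌋₊) := by
    intro b hb
    have h1 := (Finset.mem_filter.1 hb).2
    rw [distInf, ← Nat.le_floor_iff hs] at h1
    rw [Fintype.mem_piFinset]
    intro i
    have h2 := (Finset.le_sup (f := fun i => (a i - b i).natAbs) (Finset.mem_univ i)).trans h1
    rw [Finset.mem_Icc]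
    omega
  have h := Finset.card_le_card hsub
  rw [Fintype.card_piFinset] at h
  have h3 : ∀ i, (Finset.Icc (a i - ⌊s⌋₊) (a i + ⌊s⌋₊)).card = 2 * ⌊s⌋₊ + 1 := fun i => by
    rw [Int.card_Icc]; omega
  simp only [h3, Finset.prod_const, Finset.card_univ, Fintype.card_fin] at h
  calc ((S.filter fun b => distInf d a b ≤ s).card : ℝ) ≤ ((2 * ⌊s⌋₊ + 1) ^ d : ℕ) := by
        exact_mod_cast h
    _ ≤ (2 * s + 1) ^ d := by
        push_cast
        have := Nat.floor_le hs
        gcongr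

end Counting

section Density

open scoped Topology

lemma mem_VN {d n : ℕ} {a : Zd d} : a ∈ VN d n ↔ ∀ i, 0 ≤ a i ∧ a i ≤ (n : ℤ) - 1 := by
  simp [VN]

lemma natAbs_le_distInf {d : ℕ} (a b : Zd d) (i : Fin d) :
    (((a i - b i).natAbs : ℕ) : ℝ) ≤ distInf d a b :=
  Nat.cast_le.2 (Finset.le_sup (f := fun i => (a i - b i).natAbs) (Finset.mem_univ i))

lemma distInf_update_le {d : ℕ} (a : Zd d) (i : Fin d) (z : ℤ) :
    distInf d a (Function.update a i z) ≤ (a i - z).natAbs := by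
  refine Nat.cast_le.2 (Finset.sup_le fun j _ => ?_)
  rcases eq_or_ne j i with rfl | h
  · simp
  · simp [Function.update_of_ne h]

/-- The bulk is determined coordinatewise. -/
lemma mem_bulk_iff {d n : ℕ} {δ : ℝ} {a : Zd d} : a ∈ bulk d n δ ↔
    ∀ i, (0 ≤ a i ∧ a i ≤ (n : ℤ) - 1) ∧ δ * n < a i + 1 ∧ δ * n < n - a i := by
  rw [mem_bulk, mem_VN]
  constructor
  · rintro ⟨hV, hb⟩ i
    have h1 := hb (Function.update a i (-1)) fun h => by simpa using (mem_VN.1 h i).1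
    have h2 := hb (Function.update a i n) fun h => by simpa using (mem_VN.1 h i).2
    have e1 := distInf_update_le a i (-1)
    have e2 := distInf_update_le a i n
    have f1 : (((a i - -1).natAbs : ℕ) : ℝ) = a i + 1 := by
      have : (((a i - -1).natAbs : ℕ) : ℤ) = a i + 1 := by have := (hV i).1; omega
      generalize (a i - -1).natAbs = k at this ⊢
      exact_mod_cast this
    have f2 : (((a i - n).natAbs : ℕ) : ℝ) = n - a i := by
      have : (((a i - n).natAbs : ℕ) : ℤ) = n - a i := by have := (hV i).2; omega
      generalize (a i - n).natAbs = k at this ⊢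
      exact_mod_cast this
    exact ⟨hV i, by linarith, by linarith⟩
  · intro h
    refine ⟨fun i => (h i).1, fun b hb => ?_⟩
    rw [mem_VN] at hb
    push Not at hb
    obtain ⟨i, hi⟩ := hb
    have hdist := natAbs_le_distInf a b i
    obtain ⟨h1, h2, h3⟩ := h i
    by_cases hbi : 0 ≤ b i
    · have h4 : (n : ℤ) - a i ≤ ((a i - b i).natAbs : ℕ) := by have := hi hbi; omega
      generalize (a i - b i).natAbs = k at h4 hdist
      have : (n : ℝ) - a i ≤ k := by exact_mod_cast h4
      linarith
    · have h4 : a i + 1 ≤ ((a i - b i).natAbs : ℕ) := by omega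
      generalize (a i - b i).natAbs = k at h4 hdist
      have : (a i : ℝ) + 1 ≤ k := by exact_mod_cast h4
      linarith

open Classical in
/-- The possible values of a coordinate of a bulk point `a` with `a / n ∈ (lo, hi]`. -/
noncomputable def bulkCoord (n : ℕ) (δ lo hi : ℝ) : Finset ℤ :=
  (Finset.Icc (0 : ℤ) ((n : ℤ) - 1)).filter fun z =>
    δ * n < z + 1 ∧ δ * n < n - z ∧ (z : ℝ) / n ∈ Ioc lo hi

lemma rectIdxBulk_eq_piFinset {d n : ℕ} (hn : 0 < n) (δ : ℝ) (lo hi : Fin d → ℝ) :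
    rectIdxBulk d n δ lo hi = Fintype.piFinset fun i => bulkCoord n δ (lo i) (hi i) := by
  classical
  ext a
  have hn' : (0 : ℝ) < n := by exact_mod_cast hn
  simp only [rectIdxBulk, Finset.mem_filter, mem_bulk_iff, rect, mem_ofPred_eq,
    Fintype.mem_piFinset, bulkCoord, Finset.mem_Icc, mem_inter_iff]
  rw [← forall_and]
  refine forall_congr' fun i => ⟨fun h => ⟨h.1.1, h.1.2.1, h.1.2.2, h.2.2⟩, fun h =>
    ⟨⟨h.1, h.2.1, h.2.2.1⟩, ⟨?_, ?_⟩, h.2.2.2⟩⟩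
  · have : (0 : ℝ) ≤ a i := by exact_mod_cast h.1.1
    positivity
  · rw [div_le_one hn']
    have : a i ≤ (n : ℤ) := by linarith [h.1.2]
    exact_mod_cast this

lemma abs_card_bulkCoord_div_sub_le {n : ℕ} (hn : 0 < n) {δ : ℝ} (hδ : 0 < δ) (lo hi : ℝ) :
    |((bulkCoord n δ lo hi).card : ℝ) / n - max (min (1 - δ) hi - max δ lo) 0| ≤ 2 / n := by
  classical
  have hn' : (0 : ℝ) < n := by exact_mod_cast hn
  have hδn : 0 < δ * n := by positivity
  set L := max δ lo
  set H := min (1 - δ) hi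
  have hL1 : δ ≤ L := le_max_left _ _
  have hL2 : lo ≤ L := le_max_right _ _
  have hH1 : H ≤ 1 - δ := min_le_left _ _
  have hH2 : H ≤ hi := min_le_right _ _
  have hup : bulkCoord n δ lo hi ⊆ Finset.Icc ⌊L * n⌋ ⌊H * n⌋ := by
    intro z hz
    obtain ⟨-, h1, h2, h3, h4⟩ := Finset.mem_filter.1 hz
    rw [lt_div_iff₀ hn'] at h3
    rw [div_le_iff₀ hn'] at h4
    have hzL : L * n < z + 1 := by
      rcases max_choice δ lo with h | h <;> simp only [L, h] <;> linarith
    have hzH : (z : ℝ) ≤ H * n := by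
      rcases min_choice (1 - δ) hi with h | h <;> simp only [H, h] <;> linarith
    rw [Finset.mem_Icc]
    refine ⟨?_, Int.le_floor.2 hzH⟩
    have : ⌊L * n⌋ < z + 1 := Int.floor_lt.2 (by push_cast; exact hzL)
    omega
  have hlow : Finset.Icc (⌊L * n⌋ + 1) (⌈H * n⌉ - 1) ⊆ bulkCoord n δ lo hi := by
    intro z hz
    rw [Finset.mem_Icc] at hz
    have hzL : L * n < z := Int.floor_lt.1 (by omega)
    have hzH : (z : ℝ) < H * n := Int.lt_ceil.1 (by omega)
    have a1 : δ * n ≤ L * n := by gcongr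
    have a2 : lo * n ≤ L * n := by gcongr
    have a3 : H * n ≤ (1 - δ) * n := by gcongr
    have a4 : H * n ≤ hi * n := by gcongr
    refine Finset.mem_filter.2 ⟨Finset.mem_Icc.2 ⟨?_, ?_⟩, by linarith, by linarith, ?_, ?_⟩
    · have : (0 : ℝ) ≤ z := by linarith
      exact_mod_cast this
    · have : (z : ℝ) < (n : ℤ) := by push_cast; linarith
      have : z < n := by exact_mod_cast this
      omega
    · rw [lt_div_iff₀ hn']; linarith
    · rw [div_le_iff₀ hn']; linarith
  have h1 := Finset.card_le_card hup
  have h2 := Finset.card_le_card hlow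
  rw [Int.card_Icc] at h1 h2
  have f1 := Int.floor_le (L * n)
  have f2 := Int.lt_floor_add_one (L * n)
  have f3 := Int.floor_le (H * n)
  have f4 := Int.le_ceil (H * n)
  have hT1 : ((bulkCoord n δ lo hi).card : ℝ) ≤ max (H - L) 0 * n + 2 := by
    have : ((bulkCoord n δ lo hi).card : ℤ) ≤ max (⌊H * n⌋ + 1 - ⌊L * n⌋) 0 := by
      rw [← Int.toNat_eq_max]; exact Int.ofNat_le.2 h1
    have : ((bulkCoord n δ lo hi).card : ℝ) ≤ max ((⌊H * n⌋ : ℝ) + 1 - ⌊L * n⌋) 0 := by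
      exact_mod_cast this
    refine this.trans (max_le ?_ (by positivity))
    have : (H - L) * n ≤ max (H - L) 0 * n := by gcongr; exact le_max_left _ _
    linarith
  have hT2 : max (H - L) 0 * n - 2 ≤ ((bulkCoord n δ lo hi).card : ℝ) := by
    have h3 : ⌈H * n⌉ - 1 + 1 - (⌊L * n⌋ + 1) ≤ ((bulkCoord n δ lo hi).card : ℤ) := by omega
    have h4 : (⌈H * n⌉ : ℝ) - 1 + 1 - (⌊L * n⌋ + 1) ≤ ((bulkCoord n δ lo hi).card : ℝ) := by
      exact_mod_cast h3
    rcases max_choice (H - L) 0 with h | h <;> rw [h]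
    · linarith
    · have : (0 : ℝ) ≤ ((bulkCoord n δ lo hi).card : ℝ) := by positivity
      linarith
  have h5 : ((bulkCoord n δ lo hi).card : ℝ) / n - max (H - L) 0 =
      ((bulkCoord n δ lo hi).card - max (H - L) 0 * n) / n := by field_simp
  rw [h5, abs_div, abs_of_pos hn']
  gcongr
  rw [abs_le]
  constructor <;> linarith

lemma toReal_volume_rect_inter_deltaBox {d : ℕ} {δ : ℝ} (hδ0 : 0 < δ)
    (lo hi : Fin d → ℝ) : (volume (rect d lo hi ∩ deltaBox d δ)).toReal =
      ∏ i, max (min (1 - δ) (hi i) - max δ (lo i)) 0 := by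
  have hpi : rect d lo hi ∩ deltaBox d δ =
      Set.pi univ fun i => (Icc (0 : ℝ) 1 ∩ Ioc (lo i) (hi i)) ∩ Icc δ (1 - δ) := by
    ext t
    simp only [rect, deltaBox, mem_inter_iff, mem_ofPred_eq, mem_univ_pi, ← forall_and]
  rw [hpi, volume_pi_pi, ENNReal.toReal_prod]
  refine Finset.prod_congr rfl fun i _ => ?_
  have h : volume ((Icc (0 : ℝ) 1 ∩ Ioc (lo i) (hi i)) ∩ Icc δ (1 - δ)) =
      ENNReal.ofReal (min (1 - δ) (hi i) - max δ (lo i)) := by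
    refine le_antisymm ?_ ?_
    · rw [← Real.volume_Icc]
      refine measure_mono fun x hx => ⟨max_le hx.2.1 hx.1.2.1.le, le_min hx.2.2 hx.1.2.2⟩
    · rw [← Real.volume_Ioo]
      refine measure_mono fun x hx => ?_
      obtain ⟨h1, h2⟩ := hx
      rw [max_lt_iff] at h1
      rw [lt_min_iff] at h2
      exact ⟨⟨⟨by linarith, by linarith⟩, h1.2, h2.2.le⟩, h1.1.le, h2.1.le⟩
  rw [h, ENNReal.toReal_ofReal']

lemma tendsto_card_rectIdxBulk_div {d : ℕ} {δ : ℝ} (hδ0 : 0 < δ)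
    (lo hi : Fin d → ℝ) :
    Tendsto (fun n : ℕ => ((rectIdxBulk d n δ lo hi).card : ℝ) / ((n ^ d : ℕ) : ℝ)) atTop
      (𝓝 (volume (rect d lo hi ∩ deltaBox d δ)).toReal) := by
  rw [toReal_volume_rect_inter_deltaBox hδ0]
  have h : ∀ i, Tendsto (fun n : ℕ => ((bulkCoord n δ (lo i) (hi i)).card : ℝ) / n) atTop
      (𝓝 (max (min (1 - δ) (hi i) - max δ (lo i)) 0)) := by
    intro i
    rw [tendsto_iff_dist_tendsto_zero]
    refine squeeze_zero' (.of_forall fun _ => dist_nonneg) ?_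
      (tendsto_const_div_atTop_nhds_zero_nat 2)
    filter_upwards [eventually_gt_atTop 0] with n hn
    exact abs_card_bulkCoord_div_sub_le hn hδ0 _ _
  refine (tendsto_finsetProd Finset.univ fun i _ => h i).congr' ?_
  filter_upwards [eventually_gt_atTop 0] with n hn
  rw [rectIdxBulk_eq_piFinset hn, Fintype.card_piFinset, Finset.prod_div_distrib]
  simp

end Density

section ExtremalProcess

open scoped Topology

lemma rectIdxBulk_subset_bulk (d n : ℕ) (δ : ℝ) (lo hi : Fin d → ℝ) :
    rectIdxBulk d n δ lo hi ⊆ bulk d n δ := by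
  classical
  exact Finset.filter_subset _ _

lemma mem_rect_of_mem_rectIdxBulk {d n : ℕ} {δ : ℝ} {lo hi : Fin d → ℝ} {a : Zd d}
    (ha : a ∈ rectIdxBulk d n δ lo hi) : (fun i => (a i : ℝ) / n) ∈ rect d lo hi := by
  classical
  exact (Finset.mem_filter.1 ha).2

lemma card_rectIdxBulk_le (d n : ℕ) (δ : ℝ) (lo hi : Fin d → ℝ) :
    (rectIdxBulk d n δ lo hi).card ≤ n ^ d :=
  card_VN d n ▸ Finset.card_le_card ((rectIdxBulk_subset_bulk _ _ _ _ _).trans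
    (bulk_subset_VN _ _ _))

lemma omegaMeas_nonneg (R : Set EReal) : 0 ≤ omegaMeas R :=
  integral_nonneg fun _ => (exp_pos _).le

lemma tendsto_poly_mul_exp_neg (d : ℕ) {b : ℝ} (hb : 0 < b) :
    Tendsto (fun l : ℝ => (2 * l ^ 16 + 1) ^ d * exp (-(b * l))) atTop (𝓝 0) := by
  have h := (tendsto_rpow_mul_exp_neg_mul_atTop_nhds_zero ((16 * d : ℕ) : ℝ) b hb).const_mul
    ((3 : ℝ) ^ d)
  rw [mul_zero] at h
  refine squeeze_zero' ?_ ?_ h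
  · filter_upwards [eventually_ge_atTop 1] with l hl
    positivity
  · filter_upwards [eventually_ge_atTop 1] with l hl
    rw [Real.rpow_natCast, ← mul_assoc, pow_mul, ← mul_pow, neg_mul]
    have : 1 ≤ l ^ 16 := one_le_pow₀ hl
    gcongr
    linarith

variable {Ω : Type*} [MeasurableSpace Ω] {P : Measure Ω} {d k : ℕ} {δ : ℝ}
  {ψ : (n : ℕ) → Zd d → Ω → ℝ} {lo hi : Fin k → Fin d → ℝ} {R : Fin k → Set EReal}

/-- The expected number of points of the bulk process converges. -/
lemma tendsto_sum_intensity (hd : 3 ≤ d) (hδ : 0 < δ)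
    (hψ : ∀ n, IsGaussianField P d (greenIn d (VN d n : Set (Zd d))) (ψ n))
    (lo hi : Fin d → ℝ) {R : Set EReal} (hR : IsFiniteUnionIoc R) :
    Tendsto (fun n : ℕ => ∑ a ∈ rectIdxBulk d n δ lo hi, P.real {ω |
      (((ψ n a ω - bN (green d 0 0) (n ^ d)) / aN (green d 0 0) (n ^ d) : ℝ) : EReal) ∈ R}) atTop
      (𝓝 ((volume (rect d lo hi ∩ deltaBox d δ)).toReal * omegaMeas R)) := by
  have h1 := (tendsto_card_rectIdxBulk_div hδ lo hi).mul_const (omegaMeas R)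
  refine h1.congr_dist ?_
  rw [Metric.tendsto_nhds]
  intro ε hε
  filter_upwards [eventually_bulk_intensity hd hδ hψ hR (half_pos hε), eventually_gt_atTop 0]
    with n hn hn0
  have hN : (0 : ℝ) < ((n ^ d : ℕ) : ℝ) := by positivity
  rw [Real.dist_0_eq_abs, abs_of_nonneg dist_nonneg, dist_comm, Real.dist_eq]
  rw [div_mul_eq_mul_div, ← nsmul_eq_mul, ← Finset.sum_const, Finset.sum_div,
    ← Finset.sum_sub_distrib]
  refine (Finset.abs_sum_le_sum_abs _ _).trans_lt ?_
  have hb : ∀ a ∈ rectIdxBulk d n δ lo hi, |P.real {ω |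
      (((ψ n a ω - bN (green d 0 0) (n ^ d)) / aN (green d 0 0) (n ^ d) : ℝ) : EReal) ∈ R} -
        omegaMeas R / ((n ^ d : ℕ) : ℝ)| ≤ ε / 2 / ((n ^ d : ℕ) : ℝ) := fun a ha => by
    have := hn a (rectIdxBulk_subset_bulk _ _ _ _ _ ha)
    rwa [le_div_iff₀ hN, mul_comm, ← abs_of_pos hN, ← abs_mul, abs_of_pos hN, mul_sub,
      mul_div_cancel₀ _ hN.ne']
  refine (Finset.sum_le_card_nsmul _ _ _ hb).trans_lt ?_
  rw [nsmul_eq_mul]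
  have hc : ((rectIdxBulk d n δ lo hi).card : ℝ) ≤ ((n ^ d : ℕ) : ℝ) :=
    Nat.cast_le.2 (card_rectIdxBulk_le _ _ _ _ _)
  calc _ ≤ ((n ^ d : ℕ) : ℝ) * (ε / 2 / ((n ^ d : ℕ) : ℝ)) := by gcongr
    _ = ε / 2 := mul_div_cancel₀ _ hN.ne'
    _ < ε := half_lt_self hε

/-- Indices of the points of the bulk process lying in one of the rectangles. -/
noncomputable def bulkIndex (δ : ℝ) (lo hi : Fin k → Fin d → ℝ) (n : ℕ) :
    Finset ((_ : Fin k) × Zd d) :=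
  Finset.univ.sigma fun j => rectIdxBulk d n δ (lo j) (hi j)

/-- The event that the normalized field at `i.2` lies in `R i.1`. -/
def exceedance (ψ : (n : ℕ) → Zd d → Ω → ℝ) (R : Fin k → Set EReal) (n : ℕ)
    (i : (_ : Fin k) × Zd d) : Set Ω :=
  {ω | (((ψ n i.2 ω - bN (green d 0 0) (n ^ d)) / aN (green d 0 0) (n ^ d) : ℝ) : EReal) ∈ R i.1}

lemma mem_bulkIndex {n : ℕ} {i : (_ : Fin k) × Zd d} :
    i ∈ bulkIndex δ lo hi n ↔ i.2 ∈ rectIdxBulk d n δ (lo i.1) (hi i.1) := by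
  simp [bulkIndex]

lemma ne_of_mem_bulkIndex
    (hdisj : Pairwise fun j j' => Disjoint (rect d (lo j) (hi j)) (rect d (lo j') (hi j')))
    {n : ℕ} {i i' : (_ : Fin k) × Zd d} (hi1 : i ∈ bulkIndex δ lo hi n)
    (hi2 : i' ∈ bulkIndex δ lo hi n) (hne : i ≠ i') : i.2 ≠ i'.2 := by
  intro h
  have hj : i.1 ≠ i'.1 := fun h1 => hne (Sigma.ext h1 (heq_of_eq h))
  have h1 := mem_rect_of_mem_rectIdxBulk (mem_bulkIndex.1 hi1)
  rw [h] at h1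
  exact Set.disjoint_left.1 (hdisj hj) h1 (mem_rect_of_mem_rectIdxBulk (mem_bulkIndex.1 hi2))

lemma card_bulkIndex_le (n : ℕ) :
    ((bulkIndex δ lo hi n).card : ℝ) ≤ k * ((n ^ d : ℕ) : ℝ) := by
  rw [bulkIndex, Finset.card_sigma]
  have := Finset.sum_le_card_nsmul Finset.univ
    (fun j => (rectIdxBulk d n δ (lo j) (hi j)).card) (n ^ d)
    fun j _ => card_rectIdxBulk_le d n δ (lo j) (hi j)
  rw [Finset.card_univ, Fintype.card_fin, nsmul_eq_mul] at this
  exact_mod_cast this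

lemma card_near_bulkIndex_le (n : ℕ) (i : (_ : Fin k) × Zd d) {s : ℝ} (hs : 0 ≤ s)
    {p : (_ : Fin k) × Zd d → Prop} [DecidablePred p]
    (hp : ∀ i', p i' → distInf d i.2 i'.2 ≤ s) :
    (((bulkIndex δ lo hi n).filter p).card : ℝ) ≤ k * (2 * s + 1) ^ d := by
  classical
  have hsub : (bulkIndex δ lo hi n).filter p ⊆ Finset.univ.sigma fun j =>
      (rectIdxBulk d n δ (lo j) (hi j)).filter fun b => distInf d i.2 b ≤ s := by
    intro i' hi'
    obtain ⟨h1, h2⟩ := Finset.mem_filter.1 hi'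
    exact Finset.mem_sigma.2 ⟨Finset.mem_univ _,
      Finset.mem_filter.2 ⟨mem_bulkIndex.1 h1, hp i' h2⟩⟩
  refine (Nat.cast_le.2 (Finset.card_le_card hsub)).trans ?_
  rw [Finset.card_sigma, Nat.cast_sum]
  refine (Finset.sum_le_card_nsmul _ _ _ fun j _ => card_distInf_le d _ i.2 hs).trans_eq ?_
  simp

lemma eventually_abs_avoid_sub_exp_le [IsProbabilityMeasure P] (hd : 3 ≤ d) (hδ : 0 < δ)
    (hψ : ∀ n, IsGaussianField P d (greenIn d (VN d n : Set (Zd d))) (ψ n))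
    (hdisj : Pairwise fun j j' => Disjoint (rect d (lo j) (hi j)) (rect d (lo j') (hi j')))
    (hR : ∀ j, IsFiniteUnionIoc (R j)) {ε : ℝ} (hε : 0 < ε) :
    ∀ᶠ n in atTop, |P.real (⋂ i ∈ bulkIndex δ lo hi n, (exceedance ψ R n i)ᶜ) -
      exp (-∑ i ∈ bulkIndex δ lo hi n, P.real (exceedance ψ R n i))| ≤ ε := by
  classical
  have hd0 : 0 < d := by omega
  have hg : 0 < green d 0 0 := lt_of_lt_of_le (by norm_num) (half_le_green_zero hd)
  choose w hw using fun j => (hR j).exists_lt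
  obtain ⟨w₀, hw₀⟩ := (Set.finite_range w).bddBelow
  obtain ⟨κ, hκ, hpair⟩ := exists_eventually_pair_le hd hψ w₀
  set M : ℝ := ∑ j, omegaMeas (R j) + 1 with hM
  set ε' := ε / (2 * (k + 1)) with hε'
  have hε'0 : 0 < ε' := by positivity
  have hl := tendsto_log_pow_atTop hd0
  have hsmall : ∀ᶠ n : ℕ in atTop,
      k * (M ^ 2 * exp (-(1 * log ((n ^ d : ℕ) : ℝ)))) +
      k * (k * ((2 * log ((n ^ d : ℕ) : ℝ) ^ 16 + 1) ^ d * exp (-(κ * log ((n ^ d : ℕ) : ℝ))) +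
        M ^ 2 * ((2 * log ((n ^ d : ℕ) : ℝ) ^ 16 + 1) ^ d *
          exp (-(1 * log ((n ^ d : ℕ) : ℝ)))))) < ε / 2 := by
    have e1 := (tendsto_poly_mul_exp_neg d hκ).comp hl
    have e2 := (tendsto_poly_mul_exp_neg d one_pos).comp hl
    have e3 := (tendsto_poly_mul_exp_neg 0 one_pos).comp hl
    have := ((e3.const_mul (M ^ 2)).const_mul (k : ℝ)).add
      (((e1.add (e2.const_mul (M ^ 2))).const_mul (k : ℝ)).const_mul (k : ℝ))
    simp only [mul_zero, add_zero, Function.comp_def, pow_zero, one_mul] at this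
    simp only [one_mul]
    exact this.eventually (gt_mem_nhds (half_pos hε))
  filter_upwards [hsmall, hpair, hl.eventually_gt_atTop 0, eventually_aN_pos hg hd0,
    eventually_gt_atTop 0,
    eventually_all.2 fun j => eventually_bulk_intensity hd hδ hψ (hR j) one_pos,
    eventually_all.2 fun j => eventually_abs_inter_far_le hd hδ hψ (hR j) hε'0
      ((_ : Fin k) × Zd d)] with n hsm hpr hln haN hn hint hfar
  have hexpl := exp_log_natCast_pow hn d
  set N : ℝ := ((n ^ d : ℕ) : ℝ) with hNdef
  set l := log N
  have hN : 0 < N := by positivity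
  set S := bulkIndex δ lo hi n
  set A := exceedance ψ R n
  have hS : ∀ i ∈ S, i.2 ∈ bulk d n δ := fun i hi' =>
    rectIdxBulk_subset_bulk _ _ _ _ _ (mem_bulkIndex.1 hi')
  have hA : ∀ i, MeasurableSet (A i) := fun i =>
    (hψ n).1 i.2 (measurableSet_normalized (hR i.1) _ _)
  have hp : ∀ i ∈ S, P.real (A i) ≤ M / N := by
    intro i hi'
    have h1 := (abs_le.1 (hint i.1 i.2 (hS i hi'))).2
    have h2 := Finset.single_le_sum (f := fun j => omegaMeas (R j))
      (fun j _ => omegaMeas_nonneg _) (Finset.mem_univ i.1)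
    rw [le_div_iff₀ hN, mul_comm]
    have h3 : N * P.real (A i) - omegaMeas (R i.1) ≤ 1 := h1
    linarith
  have hM0 : 0 ≤ M := add_nonneg (Finset.sum_nonneg fun j _ => omegaMeas_nonneg _) zero_le_one
  have hpp : ∀ i ∈ S, ∀ i' ∈ S, P.real (A i) * P.real (A i') ≤ (M / N) ^ 2 := fun i h i' h' => by
    rw [sq]
    exact mul_le_mul (hp i h) (hp i' h') measureReal_nonneg (by positivity)
  have hAA : ∀ i ∈ S, ∀ i' ∈ S, i' ≠ i → P.real (A i ∩ A i') ≤ exp (-(κ * l)) / N := by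
    intro i h i' h' hne
    have hgt : ∀ i, ∀ ω ∈ A i, uN (green d 0 0) (n ^ d) w₀ < ψ n i.2 ω := by
      intro i ω hω
      have h1 := hw i.1 _ hω
      rw [EReal.coe_lt_coe_iff] at h1
      have h2 : w₀ < _ := (hw₀ (mem_range_self i.1)).trans_lt h1
      rw [lt_div_iff₀ haN] at h2
      rw [uN]
      linarith
    refine (measureReal_mono (show A i ∩ A i' ⊆ {ω | uN (green d 0 0) (n ^ d) w₀ < ψ n i.2 ω ∧
      uN (green d 0 0) (n ^ d) w₀ < ψ n i'.2 ω} from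
        fun ω hω => ⟨hgt i ω hω.1, hgt i' ω hω.2⟩)).trans
      ((hpr i.2 i'.2 (ne_of_mem_bulkIndex hdisj h h' hne.symm)).trans_eq ?_)
    rw [← hexpl, ← exp_sub]
    congr 1
    ring
  refine (abs_measureReal_avoid_sub_exp_le A hA (fun i i' => distInf d i.2 i'.2 ≤ l ^ 16)
    (fun _ => ε' / N) S ?_).trans ?_
  · intro i hiS F hFS hiF hnear
    exact hfar i.1 i.2 (hS i hiS) F (fun i => i.2)
      (fun i => {x : ℝ | (((x - bN (green d 0 0) (n ^ d)) / aN (green d 0 0) (n ^ d) : ℝ) :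
        EReal) ∈ R i.1}ᶜ)
      (fun i => (measurableSet_normalized (hR i.1) _ _).compl)
      (fun i' hi' => ⟨bulk_subset_VN _ _ _ (hS i' (hFS hi')), not_le.1 (hnear i' hi')⟩)
  · have hterm : ∀ i ∈ S, ε' / N + P.real (A i) ^ 2 +
        ∑ j ∈ S with distInf d i.2 j.2 ≤ l ^ 16 ∧ j ≠ i,
          (P.real (A i ∩ A j) + P.real (A i) * P.real (A j)) ≤
        ε' / N + (M / N) ^ 2 +
          k * (2 * l ^ 16 + 1) ^ d * (exp (-(κ * l)) / N + (M / N) ^ 2) := by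
      intro i hi'
      have h1 : P.real (A i) ^ 2 ≤ (M / N) ^ 2 := by rw [sq]; exact hpp i hi' i hi'
      have h2 : ∑ j ∈ S with distInf d i.2 j.2 ≤ l ^ 16 ∧ j ≠ i,
          (P.real (A i ∩ A j) + P.real (A i) * P.real (A j)) ≤
          k * (2 * l ^ 16 + 1) ^ d * (exp (-(κ * l)) / N + (M / N) ^ 2) := by
        refine (Finset.sum_le_card_nsmul _ _ (exp (-(κ * l)) / N + (M / N) ^ 2)
          fun j hj => ?_).trans ?_
        · obtain ⟨hjS, -, hji⟩ := Finset.mem_filter.1 hj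
          exact add_le_add (hAA i hi' j hjS hji) (hpp i hi' j hjS)
        · rw [nsmul_eq_mul]
          gcongr
          exact card_near_bulkIndex_le n i (by positivity) fun i' h => h.1
      linarith
    refine (Finset.sum_le_card_nsmul _ _ _ hterm).trans ?_
    rw [nsmul_eq_mul]
    have hcard := card_bulkIndex_le (δ := δ) (lo := lo) (hi := hi) n
    calc (S.card : ℝ) * _ ≤ (k * N) * (ε' / N + (M / N) ^ 2 +
          k * (2 * l ^ 16 + 1) ^ d * (exp (-(κ * l)) / N + (M / N) ^ 2)) := by
          gcongr
      _ = k * ε' + (k * (M ^ 2 * N⁻¹) + k * (k * ((2 * l ^ 16 + 1) ^ d * exp (-(κ * l)) +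
            M ^ 2 * ((2 * l ^ 16 + 1) ^ d * N⁻¹)))) := by
          field_simp
          ring
      _ ≤ ε / 2 + ε / 2 := by
          have h1 : k * ε' ≤ ε / 2 := by
            rw [hε', ← mul_div_assoc, div_le_div_iff₀ (by positivity) two_pos]
            nlinarith
          have h2 : exp (-(1 * l)) = N⁻¹ := by rw [one_mul, exp_neg, hexpl]
          rw [h2] at hsm
          linarith
      _ = ε := add_halves ε

end ExtremalProcess

/-- Avoidance probabilities of the bulk extremal process of the zero-boundary
DGFF on `V_N` converge to those of a Poisson point process with intensity
`dt|_{[δ,1-δ]^d} ⊗ e^{-z}dz`. -/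
theorem extremal_process_bulk
    (d : ℕ) (hd : 3 ≤ d) (δ : ℝ) (hδ0 : 0 < δ) (hδ : δ < 1 / 2)
    {Ω : Type*} [MeasurableSpace Ω] (P : Measure Ω) [IsProbabilityMeasure P]
    (ψ : (n : ℕ) → Zd d → Ω → ℝ)
    (hψ : ∀ n, IsGaussianField P d (greenIn d (VN d n : Set (Zd d))) (ψ n))
    (hψ0 : ∀ n, ∀ a ∉ VN d n, ∀ᵐ ω ∂P, ψ n a ω = 0)
    (k : ℕ) (hk : 1 ≤ k)
    (lo hi : Fin k → Fin d → ℝ) (hlohi : ∀ j i, lo j i < hi j i)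
    (hdisj : Pairwise fun j j' => Disjoint (rect d (lo j) (hi j)) (rect d (lo j') (hi j')))
    (R : Fin k → Set EReal) (hR : ∀ j, IsFiniteUnionIoc (R j)) :
    Tendsto
      (fun n : ℕ =>
        (P {ω | ∀ j : Fin k, ∀ a ∈ rectIdxBulk d n δ (lo j) (hi j),
            (((ψ n a ω - bN (green d 0 0) (n ^ d)) / aN (green d 0 0) (n ^ d) : ℝ) : EReal)
              ∉ R j}).toReal)
      atTop
      (nhds (Real.exp (-∑ j : Fin k,
        (volume (rect d (lo j) (hi j) ∩ deltaBox d δ)).toReal * omegaMeas (R j)))) := by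
  have hsum := tendsto_finsetSum Finset.univ fun j _ =>
    tendsto_sum_intensity hd hδ0 hψ (lo j) (hi j) (hR j)
  refine ((continuous_exp.tendsto _).comp hsum.neg).congr_dist ?_
  rw [Metric.tendsto_nhds]
  intro ε hε
  filter_upwards [eventually_abs_avoid_sub_exp_le hd hδ0 hψ hdisj hR (half_pos hε)] with n hn
  have hset : {ω | ∀ j : Fin k, ∀ a ∈ rectIdxBulk d n δ (lo j) (hi j),
      (((ψ n a ω - bN (green d 0 0) (n ^ d)) / aN (green d 0 0) (n ^ d) : ℝ) : EReal) ∉ R j} =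
      ⋂ i ∈ bulkIndex δ lo hi n, (exceedance ψ R n i)ᶜ := by
    ext ω
    simp only [mem_iInter, mem_bulkIndex, mem_compl_iff, exceedance, mem_ofPred_eq]
    exact ⟨fun h i hi => h i.1 i.2 hi, fun h j a ha => h ⟨j, a⟩ ha⟩
  rw [Real.dist_0_eq_abs, abs_of_nonneg dist_nonneg, dist_comm, hset, Real.dist_eq]
  have hs : ∑ i ∈ bulkIndex δ lo hi n, P.real (exceedance ψ R n i) =
      ∑ j, ∑ a ∈ rectIdxBulk d n δ (lo j) (hi j), P.real {ω |
        (((ψ n a ω - bN (green d 0 0) (n ^ d)) / aN (green d 0 0) (n ^ d) : ℝ) : EReal) ∈ R j} :=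
    Finset.sum_sigma _ _ _
  rw [hs] at hn
  exact hn.trans_lt (half_lt_self hε)
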